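/- arXiv:1112.0852 — 3 statements merged into one kernel-verified Lean document; each statement's English description precedes it below -/
import Mathlib

section
/- Let A be an artin algebra and M, N indecomposable modules in mod A with the same composition factors (counted with multiplicity). If M is not the middle of a short chain, then M and N are isomorphic. -/
universe u

variable {A : Type u} [Ring A]

/-- The category of (right) `A`-modules, modeled as modules over `Aᵐᵒᵖ`. -/
abbrev Modc (A : Type u) [Ring A] := ModuleCat.{u} Aᵐᵒᵖ

/-- A module is finitely generated. -/
def FinGen (M : Modc A) : Prop := Module.Finite Aᵐᵒᵖ M

/-- A module is indecomposable: nonzero, and its endomorphism ring has no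
nontrivial idempotents. -/
def Indec (M : Modc A) : Prop :=
  Nontrivial M ∧ ∀ e : M →ₗ[Aᵐᵒᵖ] M, e ∘ₗ e = e → e = 0 ∨ e = LinearMap.id

def IsSplitMono {M N : Modc A} (f : M →ₗ[Aᵐᵒᵖ] N) : Prop :=
  ∃ g : N →ₗ[Aᵐᵒᵖ] M, g ∘ₗ f = LinearMap.id

def IsSplitEpi {M N : Modc A} (f : M →ₗ[Aᵐᵒᵖ] N) : Prop :=
  ∃ g : N →ₗ[Aᵐᵒᵖ] M, f ∘ₗ g = LinearMap.id

/-- An irreducible morphism between modules. -/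
def IsIrred {M N : Modc A} (f : M →ₗ[Aᵐᵒᵖ] N) : Prop :=
  ¬ IsSplitMono f ∧ ¬ IsSplitEpi f ∧
  ∀ (L : Modc A) (g : M →ₗ[Aᵐᵒᵖ] L) (h : L →ₗ[Aᵐᵒᵖ] N),
    h ∘ₗ g = f → IsSplitEpi h ∨ IsSplitMono g

/-- Neighbors in the Auslander-Reiten quiver: both finitely generated
indecomposable, and isomorphic or linked by an irreducible map. -/
def Neighbor (X Y : Modc A) : Prop :=
  FinGen X ∧ FinGen Y ∧ Indec X ∧ Indec Y ∧
  (Nonempty (X ≃ₗ[Aᵐᵒᵖ] Y) ∨ (∃ f : X →ₗ[Aᵐᵒᵖ] Y, IsIrred f) ∨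
    (∃ f : Y →ₗ[Aᵐᵒᵖ] X, IsIrred f))

/-- A component of the Auslander-Reiten quiver `Γ_A`, viewed as the class of
indecomposable finitely generated modules lying in it. -/
def IsARComponent (C : Set (Modc A)) : Prop :=
  C.Nonempty ∧ (∀ X ∈ C, FinGen X ∧ Indec X) ∧
  (∀ X ∈ C, ∀ Y : Modc A, Neighbor X Y → Y ∈ C) ∧
  (∀ X ∈ C, ∀ Y ∈ C, Relation.ReflTransGen Neighbor X Y)

/-- The annihilator of a class of modules. -/
def annSet (C : Set (Modc A)) : Set A :=
  {a | ∀ X ∈ C, ∀ x : X, MulOpposite.op a • x = 0}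

/-- The annihilator of a single module. -/
def annM (M : Modc A) : Set A := {a | ∀ x : M, MulOpposite.op a • x = 0}

/-- Membership in `add C`: isomorphic to a finite direct sum of modules in `C`. -/
def InAdd (C : Set (Modc A)) (M : Modc A) : Prop :=
  ∃ (k : ℕ) (F : Fin k → Modc A), (∀ i, F i ∈ C) ∧
    Nonempty (M ≃ₗ[Aᵐᵒᵖ] ((i : Fin k) → F i))

/-- An external short path of `C`: nonzero non-isomorphisms `X → Y → Z` between
indecomposables with `X, Z ∈ C` and `Y ∉ C`. -/
def HasExtShortPath (C : Set (Modc A)) : Prop :=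
  ∃ X Y Z : Modc A, X ∈ C ∧ Z ∈ C ∧ Y ∉ C ∧ FinGen Y ∧ Indec Y ∧
    (∃ f : X →ₗ[Aᵐᵒᵖ] Y, f ≠ 0 ∧ ¬ Function.Bijective f) ∧
    (∃ g : Y →ₗ[Aᵐᵒᵖ] Z, g ≠ 0 ∧ ¬ Function.Bijective g)

/-- Projective dimension at most one. -/
def PdLE1 (X : Modc A) : Prop :=
  ∃ (P₁ P₀ : Modc A) (f : P₁ →ₗ[Aᵐᵒᵖ] P₀) (g : P₀ →ₗ[Aᵐᵒᵖ] X),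
    Module.Projective Aᵐᵒᵖ P₁ ∧ Module.Projective Aᵐᵒᵖ P₀ ∧
    Function.Injective f ∧ Function.Surjective g ∧
    LinearMap.range f = LinearMap.ker g

/-- Projective dimension at most two. -/
def PdLE2 (X : Modc A) : Prop :=
  ∃ (P₂ P₁ P₀ : Modc A) (f : P₂ →ₗ[Aᵐᵒᵖ] P₁) (g : P₁ →ₗ[Aᵐᵒᵖ] P₀)
    (h : P₀ →ₗ[Aᵐᵒᵖ] X),
    Module.Projective Aᵐᵒᵖ P₂ ∧ Module.Projective Aᵐᵒᵖ P₁ ∧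
    Module.Projective Aᵐᵒᵖ P₀ ∧
    Function.Injective f ∧ Function.Surjective h ∧
    LinearMap.range f = LinearMap.ker g ∧ LinearMap.range g = LinearMap.ker h

/-- Injective dimension at most one. -/
def IdLE1 (X : Modc A) : Prop :=
  ∃ (I₀ I₁ : Modc A) (f : X →ₗ[Aᵐᵒᵖ] I₀) (g : I₀ →ₗ[Aᵐᵒᵖ] I₁),
    Module.Injective Aᵐᵒᵖ I₀ ∧ Module.Injective Aᵐᵒᵖ I₁ ∧
    Function.Injective f ∧ Function.Surjective g ∧
    LinearMap.range f = LinearMap.ker g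

/-- An almost split (Auslander-Reiten) sequence `0 → T → E → X → 0`; then
`T = τ_A X` and `X = τ_A⁻ T`. -/
def IsAlmostSplitSeq (T E X : Modc A) (f : T →ₗ[Aᵐᵒᵖ] E) (g : E →ₗ[Aᵐᵒᵖ] X) : Prop :=
  Function.Injective f ∧ Function.Surjective g ∧
  LinearMap.range f = LinearMap.ker g ∧
  Indec T ∧ Indec X ∧ ¬ IsSplitEpi g ∧
  (∀ (V : Modc A) (h : V →ₗ[Aᵐᵒᵖ] X), ¬ IsSplitEpi h → ∃ k : V →ₗ[Aᵐᵒᵖ] E, g ∘ₗ k = h) ∧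
  (∀ (V : Modc A) (h : T →ₗ[Aᵐᵒᵖ] V), ¬ IsSplitMono h → ∃ k : E →ₗ[Aᵐᵒᵖ] V, k ∘ₗ f = h)

/-- A generator of the radical of `mod A`: a map factoring through a
non-isomorphism between finitely generated indecomposables. -/
def IsNonIsoGen {X Y : Modc A} (f : X →ₗ[Aᵐᵒᵖ] Y) : Prop :=
  ∃ (M N : Modc A) (u : M →ₗ[Aᵐᵒᵖ] N) (g : X →ₗ[Aᵐᵒᵖ] M) (h : N →ₗ[Aᵐᵒᵖ] Y),
    FinGen M ∧ Indec M ∧ FinGen N ∧ Indec N ∧ ¬ Function.Bijective u ∧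
    f = h ∘ₗ (u ∘ₗ g)

/-- The radical `rad_A(X, Y)`: the ideal of `mod A` generated by all
non-isomorphisms between indecomposables. -/
def rad1 (X Y : Modc A) : AddSubgroup (X →ₗ[Aᵐᵒᵖ] Y) :=
  AddSubgroup.closure {f | IsNonIsoGen f}

/-- Powers of the radical: `radPow n = rad_A^(n+1)`. -/
def radPow : ℕ → (X Y : Modc A) → AddSubgroup (X →ₗ[Aᵐᵒᵖ] Y)
  | 0 => rad1
  | n + 1 => fun X Y => AddSubgroup.closure
      {f | ∃ (Z : Modc A) (g : X →ₗ[Aᵐᵒᵖ] Z) (h : Z →ₗ[Aᵐᵒᵖ] Y),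
        FinGen Z ∧ g ∈ radPow n X Z ∧ h ∈ rad1 Z Y ∧ f = h ∘ₗ g}

/-- The infinite radical `rad_A^∞(X, Y) = ⋂_{i ≥ 1} rad_A^i(X, Y)`. -/
def radInf (X Y : Modc A) : AddSubgroup (X →ₗ[Aᵐᵒᵖ] Y) := ⨅ n : ℕ, radPow n X Y

/-- `X` is (isomorphic to) a direct summand of `M`. -/
def IsDirectSummandOf (X M : Modc A) : Prop :=
  ∃ (ι : X →ₗ[Aᵐᵒᵖ] M) (ρ : M →ₗ[Aᵐᵒᵖ] X), ρ ∘ₗ ι = LinearMap.id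



/-- `M` and `N` have the same composition factors (counted with multiplicity):
there are filtrations of the same length with factor-wise isomorphic
subquotients after a permutation. -/
def SameCompFactors {A : Type u} [Ring A] (M N : Modc A) : Prop :=
  ∃ (n : ℕ) (s : Fin (n + 1) → Submodule Aᵐᵒᵖ M)
    (t : Fin (n + 1) → Submodule Aᵐᵒᵖ N) (σ : Equiv.Perm (Fin n)),
    Monotone s ∧ Monotone t ∧
    s 0 = ⊥ ∧ s (Fin.last n) = ⊤ ∧ t 0 = ⊥ ∧ t (Fin.last n) = ⊤ ∧
    ∀ i : Fin n, Nonempty (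
      (↥(s i.succ) ⧸ (Submodule.comap (s i.succ).subtype (s i.castSucc))) ≃ₗ[Aᵐᵒᵖ]
      (↥(t (σ i).succ) ⧸ (Submodule.comap (t (σ i).succ).subtype (t (σ i).castSucc))))

/-- `M` is the middle of a short chain `X → M → τ_A X`, where `τ_A X` is
encoded by an almost split sequence ending at `X`. -/
def IsMiddleOfShortChain {A : Type u} [Ring A] (M : Modc A) : Prop :=
  ∃ (X T E : Modc A) (f : T →ₗ[Aᵐᵒᵖ] E) (g : E →ₗ[Aᵐᵒᵖ] X),
    FinGen X ∧ IsAlmostSplitSeq T E X f g ∧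
    (∃ u : X →ₗ[Aᵐᵒᵖ] M, u ≠ 0) ∧ (∃ v : M →ₗ[Aᵐᵒᵖ] T, v ≠ 0)

theorem Module.Baer.of_retract {R Q E : Type*} [Ring R] [AddCommGroup Q] [Module R Q]
    [AddCommGroup E] [Module R E] (hQ : Module.Baer R Q) (i : E →ₗ[R] Q) (r : Q →ₗ[R] E)
    (hri : ∀ x, r (i x) = x) : Module.Baer R E := fun I g ↦ by
  obtain ⟨g', hg'⟩ := hQ I (i ∘ₗ g)
  exact ⟨r ∘ₗ g', fun x hx ↦ by simp [hg' x hx, hri]⟩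

section Cogenerator

variable {K : Type u} [CommRing K] {I : Type u} [AddCommGroup I] [Module K I]

/-- Every nonzero element of `F` generates a submodule containing `S`. -/
def IsEssentialOver (S F : Submodule K I) : Prop :=
  S ≤ F ∧ ∀ v ∈ F, v ≠ 0 → S ≤ Submodule.span K {v}

theorem length_linearMap_le_one {Q : Type u} [AddCommGroup Q] [Module K Q] [IsSimpleModule K Q]
    {S F : Submodule K I} (hS : IsSimpleModule K S) (hF : IsEssentialOver S F) :
    Module.length K (Q →ₗ[K] F) ≤ 1 := by
  have := IsSimpleModule.nontrivial K Q
  have := IsSimpleModule.nontrivial K S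
  obtain ⟨q, hq⟩ := exists_ne (0 : Q)
  have hspan : Submodule.span K {q} = ⊤ := IsSimpleModule.span_singleton_eq_top K hq
  have hmem : ∀ f : Q →ₗ[K] F, ((f q : F) : I) ∈ S := by
    intro f
    by_cases h0 : f q = 0
    · simp [h0]
    · have hf : Function.Injective f :=
        (LinearMap.injective_or_eq_zero f).resolve_right (by rintro rfl; simp at h0)
      have hne : ((f q : F) : I) ≠ 0 := by simpa using h0
      have hle := hF.2 _ (f q).2 hne
      obtain ⟨s, hs⟩ := exists_ne (0 : S)
      obtain ⟨a, ha⟩ := Submodule.mem_span_singleton.1 (hle s.2)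
      have haq : a • q ≠ 0 := by
        intro h
        apply hs
        have : f (a • q) = 0 := by rw [h, map_zero]
        rw [map_smul] at this
        ext
        rw [← ha]
        simpa using congrArg Subtype.val this
      have : q ∈ Submodule.span K {a • q} := by
        rw [IsSimpleModule.span_singleton_eq_top K haq]; trivial
      obtain ⟨b, hb⟩ := Submodule.mem_span_singleton.1 this
      rw [← hb, map_smul, map_smul]
      change b • a • ((f q : F) : I) ∈ S
      rw [ha]
      exact S.smul_mem _ s.2
  let ev : (Q →ₗ[K] F) →ₗ[K] S :=
    { toFun := fun f ↦ ⟨(f q : F), hmem f⟩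
      map_add' := fun _ _ ↦ rfl
      map_smul' := fun _ _ ↦ rfl }
  have hinj : Function.Injective ev := by
    rw [← LinearMap.ker_eq_bot, LinearMap.ker_eq_bot']
    intro f hf
    have : f q = 0 := by
      ext
      simpa [ev] using congrArg Subtype.val hf
    refine LinearMap.ext_on hspan ?_
    intro x hx
    rw [Set.mem_singleton_iff.1 hx, this]; rfl
  calc _ ≤ Module.length K S := Module.length_le_of_injective ev hinj
    _ = 1 := Module.length_eq_one K S

theorem length_linearMap_le {S F : Submodule K I} (hS : IsSimpleModule K S)
    (hF : IsEssentialOver S F) {Y : Type u} [AddCommGroup Y] [Module K Y]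
    (hY : IsFiniteLength K Y) :
    Module.length K (Y →ₗ[K] F) ≤ Module.length K Y := by
  induction hY with
  | of_subsingleton =>
    rw [Module.length_eq_zero_iff.2]
    · exact zero_le
    · exact ⟨fun f g ↦ LinearMap.ext fun x ↦ by simp [Subsingleton.elim x 0]⟩
  | @of_simple_quotient M _ _ N _ _ ih =>
    have h1 : Module.length K M = Module.length K N + Module.length K (M ⧸ N) :=
      Module.length_eq_add_of_exact N.subtype N.mkQ N.injective_subtype N.mkQ_surjective
        (LinearMap.exact_subtype_mkQ N)
    let r : (M →ₗ[K] F) →ₗ[K] (N →ₗ[K] F) := LinearMap.lcomp K F N.subtype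
    let j : ((M ⧸ N) →ₗ[K] F) →ₗ[K] (M →ₗ[K] F) := LinearMap.lcomp K F N.mkQ
    have hj : Function.Injective j := by
      intro f g h
      ext x
      exact congrArg Subtype.val (LinearMap.congr_fun h x)
    have h2 : Module.length K (M →ₗ[K] F) =
        Module.length K ((M ⧸ N) →ₗ[K] F) + Module.length K (LinearMap.range r) := by
      refine Module.length_eq_add_of_exact j r.rangeRestrict hj
        r.surjective_rangeRestrict ?_
      intro f
      constructor
      · intro hf
        have hf' : r f = 0 := congrArg Subtype.val hf
        refine ⟨N.liftQ f ?_, ?_⟩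
        · intro x hx
          exact LinearMap.congr_fun hf' ⟨x, hx⟩
        · ext x; rfl
      · rintro ⟨g, rfl⟩
        ext x
        change ((g (N.mkQ x) : F) : I) = 0
        rw [Submodule.mkQ_apply, (Submodule.Quotient.mk_eq_zero N).2 x.2, map_zero]; rfl
    have h3 : Module.length K (LinearMap.range r) ≤ Module.length K (N →ₗ[K] F) :=
      Module.length_le_of_injective (LinearMap.range r).subtype (Submodule.injective_subtype _)
    rw [h1, h2, add_comm]
    refine add_le_add (h3.trans ih) ?_
    rw [Module.length_eq_one K (M ⧸ N)]
    exact length_linearMap_le_one hS hF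

theorem IsEssentialOver.finite [IsArtinianRing K] {S F : Submodule K I}
    (hS : IsSimpleModule K S) (hF : IsEssentialOver S F) : Module.Finite K F := by
  have hK : IsFiniteLength K K := isFiniteLength_iff_isNoetherian_isArtinian.2
    ⟨inferInstance, inferInstance⟩
  have h := length_linearMap_le hS hF hK
  rw [LinearEquiv.length_eq (LinearMap.ringLmapEquivSelf K K F)] at h
  have h' : Module.length K F ≠ ⊤ := fun h0 ↦ Module.length_ne_top_iff.2 hK (by simpa [h0] using h)
  have := (isFiniteLength_iff_isNoetherian_isArtinian.1 (Module.length_ne_top_iff.1 h')).1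
  infer_instance

theorem exists_maximal_essential {S : Submodule K I} (hS : IsSimpleModule K S) :
    ∃ E : Submodule K I, Maximal (IsEssentialOver S) E := by
  obtain ⟨E, -, hE⟩ := zorn_le_nonempty₀ {F | IsEssentialOver S F} (fun c hc hchain y hy ↦ by
    refine ⟨sSup c, ⟨(hc hy).1.trans (le_sSup hy), fun v hv hv0 ↦ ?_⟩, fun z hz ↦ le_sSup hz⟩
    obtain ⟨F, hF, hvF⟩ := (Submodule.mem_sSup_of_directed ⟨y, hy⟩ hchain.directedOn).1 hv
    exact (hc hF).2 v hvF hv0) S ⟨le_rfl, fun v hv hv0 ↦ by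
      intro s hs
      have : (⟨s, hs⟩ : S) ∈ Submodule.span K {(⟨v, hv⟩ : S)} := by
        rw [IsSimpleModule.span_singleton_eq_top K (by simpa using hv0)]; trivial
      obtain ⟨a, ha⟩ := Submodule.mem_span_singleton.1 this
      exact Submodule.mem_span_singleton.2 ⟨a, congrArg Subtype.val ha⟩⟩
  exact ⟨E, hE⟩

theorem exists_maximal_disjoint (E : Submodule K I) :
    ∃ U : Submodule K I, Maximal (fun U ↦ Disjoint U E) U := by
  obtain ⟨U, -, hU⟩ := zorn_le_nonempty₀ {F : Submodule K I | Disjoint F E}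
    (fun c hc hchain y hy ↦ by
      refine ⟨sSup c, ?_, fun z hz ↦ le_sSup hz⟩
      refine Submodule.disjoint_def.2 fun v hv hvE ↦ ?_
      obtain ⟨F, hF, hvF⟩ := (Submodule.mem_sSup_of_directed ⟨y, hy⟩ hchain.directedOn).1 hv
      exact Submodule.disjoint_def.1 (hc hF) v hvF hvE) ⊥ disjoint_bot_left
  exact ⟨U, hU⟩

theorem Maximal.baer_of_isEssentialOver (hI : Module.Baer K I) {S E : Submodule K I}
    (hE : Maximal (IsEssentialOver S) E) : Module.Baer K E := by
  obtain ⟨U, hU⟩ := exists_maximal_disjoint E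
  have hinj : Function.Injective (U.mkQ ∘ₗ E.subtype) := by
    rw [← LinearMap.ker_eq_bot, LinearMap.ker_eq_bot']
    intro x hx
    ext
    exact Submodule.disjoint_def.1 hU.prop _ (by simpa using hx) x.2
  obtain ⟨p, hp⟩ := hI.extension_property _ hinj E.subtype
  have hpE : ∀ x ∈ E, p (U.mkQ x) = x := fun x hx ↦ LinearMap.congr_fun hp ⟨x, hx⟩
  let q : I →ₗ[K] I := p ∘ₗ U.mkQ
  have hEq : E ≤ LinearMap.range q := fun x hx ↦ ⟨x, hpE x hx⟩
  have hess : IsEssentialOver S (LinearMap.range q) := by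
    refine ⟨hE.prop.1.trans hEq, ?_⟩
    rintro _ ⟨y, rfl⟩ hv
    have hy : y ∉ U := fun h ↦ hv (by simp [q, (Submodule.Quotient.mk_eq_zero U).2 h])
    have hnd : ¬ Disjoint (U ⊔ Submodule.span K {y}) E := fun h ↦
      hy (hU.le_of_ge h le_sup_left
        (le_sup_right (a := U) (Submodule.mem_span_singleton_self y)))
    rw [Submodule.disjoint_def] at hnd
    push Not at hnd
    obtain ⟨e, he, heE, he0⟩ := hnd
    obtain ⟨w, hw, z, hz, rfl⟩ := Submodule.mem_sup.1 he
    obtain ⟨a, rfl⟩ := Submodule.mem_span_singleton.1 hz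
    refine (hE.prop.2 _ heE he0).trans ?_
    rw [Submodule.span_singleton_le_iff_mem, Submodule.mem_span_singleton]
    refine ⟨a, ?_⟩
    have := hpE _ heE
    rw [← this, map_add, (Submodule.mkQ_apply U w).trans ((Submodule.Quotient.mk_eq_zero U).2 hw)]
    simp [q]
  have hr : LinearMap.range q ≤ E := hE.le_of_ge hess hEq
  refine hI.of_retract E.subtype (q.codRestrict E fun x ↦ hr ⟨x, rfl⟩) fun x ↦ ?_
  ext
  exact hpE x x.2

end Cogenerator

theorem exists_baer_embedding (R : Type u) [Ring R] (V : Type u) [AddCommGroup V] [Module R V] :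
    ∃ (I : Type u) (_ : AddCommGroup I) (_ : Module R I) (i : V →ₗ[R] I),
      Module.Baer R I ∧ Function.Injective i := by
  let J := CategoryTheory.Injective.under (ModuleCat.of R V)
  refine ⟨J, inferInstance, inferInstance, (CategoryTheory.Injective.ι (ModuleCat.of R V)).hom,
    ?_, ?_⟩
  · have : CategoryTheory.Injective (ModuleCat.of R J) :=
      inferInstanceAs (CategoryTheory.Injective J)
    exact Module.Baer.of_injective (Module.injective_module_of_injective_object R J)
  · exact (ModuleCat.mono_iff_injective _).1 inferInstance

theorem exists_finite_baer_of_isMaximal {K : Type u} [CommRing K] [IsArtinianRing K]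
    (m : Ideal K) [hm : m.IsMaximal] :
    ∃ (E : Type u) (_ : AddCommGroup E) (_ : Module K E) (i : (K ⧸ m) →ₗ[K] E),
      Module.Finite K E ∧ Module.Baer K E ∧ Function.Injective i := by
  obtain ⟨I, _, _, i, hI, hi⟩ := exists_baer_embedding K (K ⧸ m)
  have hs : IsSimpleModule K (K ⧸ m) := isSimpleModule_iff_isCoatom.2 hm.out
  have hS : IsSimpleModule K (LinearMap.range i) :=
    IsSimpleModule.congr (LinearEquiv.ofInjective i hi).symm
  obtain ⟨E, hE⟩ := exists_maximal_essential hS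
  refine ⟨E, inferInstance, inferInstance,
    i.codRestrict E fun x ↦ hE.prop.1 ⟨x, rfl⟩, hE.prop.finite hS,
    hE.baer_of_isEssentialOver hI, fun x y h ↦ hi (congrArg Subtype.val h)⟩

/-- A commutative artinian ring has a finitely generated injective cogenerator. -/
theorem exists_finite_injective_cogenerator (K : Type u) [CommRing K] [IsArtinianRing K] :
    ∃ (E : Type u) (_ : AddCommGroup E) (_ : Module K E),
      Module.Finite K E ∧ Module.Baer K E ∧
      ∀ (V : Type u) [AddCommGroup V] [Module K V] (v : V), v ≠ 0 →
        ∃ f : V →ₗ[K] E, f v ≠ 0 := by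
  classical
  choose E h1 h2 i hfin hinj hi using
    fun m : MaximalSpectrum K ↦ exists_finite_baer_of_isMaximal m.asIdeal (hm := m.isMaximal)
  have : ∀ m, Module.Injective K (E m) := fun m ↦ (hinj m).injective
  have hB : Module.Baer K (∀ m, E m) := Module.Baer.of_injective inferInstance
  refine ⟨∀ m, E m, inferInstance, inferInstance, inferInstance, hB, ?_⟩
  intro V _ _ v hv
  let t := LinearMap.toSpanSingleton K V v
  have hne : LinearMap.ker t ≠ ⊤ := fun h ↦ hv (by
    have : (1 : K) ∈ LinearMap.ker t := h ▸ trivial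
    simpa [t] using this)
  obtain ⟨m, hm, hle⟩ := Ideal.exists_le_maximal _ hne
  let m' : MaximalSpectrum K := ⟨m, hm⟩
  let g : (K ⧸ LinearMap.ker t) →ₗ[K] ∀ m, E m :=
    LinearMap.single K E m' ∘ₗ i m' ∘ₗ Submodule.mapQ _ _ LinearMap.id hle
  obtain ⟨f, hf⟩ := hB.extension_property ((LinearMap.ker t).liftQ t le_rfl)
    (LinearMap.ker_eq_bot.1 (Submodule.ker_liftQ_eq_bot _ _ _ le_rfl)) g
  refine ⟨f, fun h0 ↦ ?_⟩
  have h := LinearMap.congr_fun hf (Submodule.Quotient.mk 1)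
  have h3 : i m' (Submodule.Quotient.mk 1) = 0 := by
    have := congrFun h m'
    simp only [LinearMap.comp_apply, Submodule.liftQ_apply, g, Submodule.mapQ_apply] at this
    simpa [t, h0] using this.symm
  have := hi m' (h3.trans (map_zero _).symm)
  rw [Submodule.Quotient.mk_eq_zero] at this
  exact hm.ne_top ((Ideal.eq_top_iff_one _).2 this)

theorem Module.Baer.exists_comp_eq {R E A B : Type*} [Ring R] [AddCommGroup E] [Module R E]
    [AddCommGroup A] [Module R A] [AddCommGroup B] [Module R B] (hE : Module.Baer R E)
    (δ : A →ₗ[R] B) (τ : A →ₗ[R] E) (h : LinearMap.ker δ ≤ LinearMap.ker τ) :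
    ∃ l : B →ₗ[R] E, l ∘ₗ δ = τ := by
  obtain ⟨l, hl⟩ := hE.extension_property ((LinearMap.ker δ).liftQ δ le_rfl)
    (LinearMap.ker_eq_bot.1 (Submodule.ker_liftQ_eq_bot _ _ _ le_rfl))
    ((LinearMap.ker δ).liftQ τ h)
  exact ⟨l, LinearMap.ext fun x ↦ by
    simpa using LinearMap.congr_fun hl (Submodule.Quotient.mk x)⟩

section Coinduced

variable (K R E : Type u) [CommRing K] [Ring R] [Algebra K R] [AddCommGroup E] [Module K E]

/-- The coinduced module `Hom_K(R, E)`, with `(r • f) s = f (s * r)`. -/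
def Coinduced : Type u := R →ₗ[K] E

namespace Coinduced

instance : AddCommGroup (Coinduced K R E) := inferInstanceAs (AddCommGroup (R →ₗ[K] E))

instance : Module K (Coinduced K R E) := inferInstanceAs (Module K (R →ₗ[K] E))

variable {K R E}

/-- The value of an element of `Hom_K(R, E)` at `s : R`. -/
def eval (f : Coinduced K R E) (s : R) : E := (show R →ₗ[K] E from f) s

@[ext] theorem ext {f g : Coinduced K R E} (h : ∀ s, f.eval s = g.eval s) : f = g :=
  LinearMap.ext h

instance : SMul R (Coinduced K R E) where
  smul r f := (show R →ₗ[K] E from f) ∘ₗ LinearMap.mulRight K r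

@[simp] theorem eval_smul (r : R) (f : Coinduced K R E) (s : R) :
    (r • f).eval s = f.eval (s * r) := rfl

@[simp] theorem eval_add (f g : Coinduced K R E) (s : R) :
    (f + g).eval s = f.eval s + g.eval s := rfl

@[simp] theorem eval_zero (s : R) : (0 : Coinduced K R E).eval s = 0 := rfl

@[simp] theorem eval_smul' (k : K) (f : Coinduced K R E) (s : R) :
    (k • f).eval s = k • f.eval s := rfl

@[simp] theorem eval_add_right (f : Coinduced K R E) (s t : R) :
    f.eval (s + t) = f.eval s + f.eval t := map_add (show R →ₗ[K] E from f) s t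

@[simp] theorem eval_zero_right (f : Coinduced K R E) : f.eval 0 = 0 :=
  map_zero (show R →ₗ[K] E from f)

@[simp] theorem eval_smul_right (f : Coinduced K R E) (k : K) (s : R) :
    f.eval (k • s) = k • f.eval s := map_smul (show R →ₗ[K] E from f) k s

instance : Module R (Coinduced K R E) where
  one_smul f := by ext; simp
  mul_smul r s f := by ext; simp [mul_assoc]
  smul_zero r := by ext; simp
  smul_add r f g := by ext; simp
  add_smul r s f := by ext; simp [mul_add]
  zero_smul f := by ext; simp

instance : IsScalarTower K R (Coinduced K R E) where
  smul_assoc k r f := by ext; simp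

instance [IsArtinianRing K] [Module.Finite K R] [Module.Finite K E] :
    Module.Finite K (Coinduced K R E) := by
  obtain ⟨n, π, hπ⟩ := Module.Finite.exists_fin' K R
  let c : Coinduced K R E →ₗ[K] (Fin n → E) :=
    { toFun := fun f i ↦ f.eval (π (Pi.single i 1))
      map_add' := fun _ _ ↦ rfl
      map_smul' := fun _ _ ↦ rfl }
  refine Module.Finite.of_injective c fun f g h ↦ ?_
  have h2 : (show R →ₗ[K] E from f) ∘ₗ π = (show R →ₗ[K] E from g) ∘ₗ π := by
    refine LinearMap.pi_ext' fun i ↦ LinearMap.ext_ring ?_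
    exact congrFun h i
  exact (LinearMap.cancel_right hπ).1 h2

instance [IsArtinianRing K] [Module.Finite K R] [Module.Finite K E] :
    Module.Finite R (Coinduced K R E) :=
  Module.Finite.of_restrictScalars_finite K R _

/-- The `R`-linear map into `Hom_K(R, E)` corresponding to a `K`-linear map into `E`. -/
def lift {V : Type*} [AddCommGroup V] [Module R V] [Module K V] [IsScalarTower K R V]
    (l : V →ₗ[K] E) : V →ₗ[R] Coinduced K R E where
  toFun v := l ∘ₗ (LinearMap.toSpanSingleton R V v).restrictScalars K
  map_add' v w := by
    apply LinearMap.ext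
    intro s
    change l (s • (v + w)) = l (s • v) + l (s • w)
    rw [smul_add, map_add]
  map_smul' r v := by
    apply LinearMap.ext
    intro s
    change l (s • r • v) = l ((s * r) • v)
    rw [mul_smul]

@[simp] theorem eval_lift {V : Type*} [AddCommGroup V] [Module R V] [Module K V]
    [IsScalarTower K R V] (l : V →ₗ[K] E) (v : V) (s : R) : (lift l v).eval s = l (s • v) := rfl

theorem baer (hE : Module.Baer K E) : Module.Baer R (Coinduced K R E) := fun I g ↦ by
  let l : I →ₗ[K] E :=
    { toFun := fun x ↦ (g x).eval 1
      map_add' := by simp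
      map_smul' := fun k x ↦ by
        have : k • x = (algebraMap K R k) • x := by
          ext; simp [Algebra.smul_def]
        rw [this, map_smul]
        simp [Algebra.algebraMap_eq_smul_one] }
  obtain ⟨l', hl'⟩ := hE.extension_property (I.subtype.restrictScalars K)
    Subtype.val_injective l
  refine ⟨lift l', fun x hx ↦ ?_⟩
  ext s
  have h := LinearMap.congr_fun hl' (s • ⟨x, hx⟩)
  have h3 : l' (s • x) = (g (s • ⟨x, hx⟩)).eval 1 := h
  rw [eval_lift, h3, map_smul]
  simp

end Coinduced

end Coinduced

theorem Module.Baer.prod {R P Q : Type*} [Ring R] [AddCommGroup P] [Module R P]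
    [AddCommGroup Q] [Module R Q] (hP : Module.Baer R P) (hQ : Module.Baer R Q) :
    Module.Baer R (P × Q) := fun I g ↦ by
  obtain ⟨a, ha⟩ := hP I (LinearMap.fst R P Q ∘ₗ g)
  obtain ⟨b, hb⟩ := hQ I (LinearMap.snd R P Q ∘ₗ g)
  exact ⟨a.prod b, fun x hx ↦ Prod.ext (ha x hx) (hb x hx)⟩

/-- The scalar action of `K` on a module over a `K`-algebra `R`. -/
abbrev moduleOfAlgebra (K R V : Type*) [CommRing K] [Ring R] [Algebra K R] [AddCommGroup V]
    [Module R V] : Module K V := Module.compHom V (algebraMap K R)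

theorem moduleOfAlgebra_isScalarTower (K R V : Type*) [CommRing K] [Ring R] [Algebra K R]
    [AddCommGroup V] [Module R V] :
    letI := moduleOfAlgebra K R V
    IsScalarTower K R V :=
  let := moduleOfAlgebra K R V
  ⟨fun k r v ↦ by
    rw [Algebra.smul_def, mul_smul]; rfl⟩

/-- Finitely generated modules over an artin algebra embed in finitely generated injectives. -/
theorem exists_finite_baer_embedding (K : Type u) {R : Type u} [CommRing K] [IsArtinianRing K]
    [Ring R] [Algebra K R] [Module.Finite K R] (V : Type u) [AddCommGroup V] [Module R V]
    [IsArtinian R V] :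
    ∃ (I : Type u) (_ : AddCommGroup I) (_ : Module R I) (i : V →ₗ[R] I),
      Module.Finite R I ∧ Module.Baer R I ∧ Function.Injective i := by
  obtain ⟨E, _, _, hfin, hE, hsep⟩ := exists_finite_injective_cogenerator K
  let S : Set (Submodule R V) := {N | ∃ (I : Type u) (_ : AddCommGroup I) (_ : Module R I)
    (i : V →ₗ[R] I), Module.Finite R I ∧ Module.Baer R I ∧ N = LinearMap.ker i}
  have hne : S.Nonempty := ⟨_, Coinduced K R E, inferInstance, inferInstance, 0, inferInstance,
    Coinduced.baer hE, rfl⟩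
  obtain ⟨N, ⟨I, _, _, i, hI, hB, rfl⟩, hmin⟩ := IsArtinian.set_has_minimal S hne
  refine ⟨I, _, _, i, hI, hB, ?_⟩
  rw [← LinearMap.ker_eq_bot, LinearMap.ker_eq_bot']
  by_contra! h
  obtain ⟨v, hv, hv0⟩ := h
  let := moduleOfAlgebra K R V
  have := moduleOfAlgebra_isScalarTower K R V
  obtain ⟨f, hf⟩ := hsep V v hv0
  let i' := i.prod (Coinduced.lift f)
  refine hmin (LinearMap.ker i') ⟨I × Coinduced K R E, inferInstance, inferInstance, i',
    inferInstance, hB.prod (Coinduced.baer hE), rfl⟩ (lt_of_le_of_ne ?_ ?_)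
  · intro x hx
    exact congrArg Prod.fst (LinearMap.mem_ker.1 hx)
  · intro h
    have : v ∈ LinearMap.ker i' := h ▸ hv
    have h2 := congrArg Prod.snd (LinearMap.mem_ker.1 this)
    have h3 := congrArg (fun t ↦ Coinduced.eval t 1) h2
    apply hf
    simpa [i'] using h3

section Indecomposable

variable {R M : Type*} [Ring R] [AddCommGroup M] [Module R M]

/-- A nonzero module without nontrivial idempotent endomorphisms. -/
def IsIndecomposableModule (R M : Type*) [Ring R] [AddCommGroup M] [Module R M] : Prop :=
  Nontrivial M ∧ ∀ e : M →ₗ[R] M, e ∘ₗ e = e → e = 0 ∨ e = LinearMap.id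

theorem IsIndecomposableModule.eq_bot_or_eq_bot (h : IsIndecomposableModule R M)
    {p q : Submodule R M} (hpq : IsCompl p q) : p = ⊥ ∨ q = ⊥ := by
  rcases h.2 (p.projection q hpq) (Submodule.isIdempotentElem_projection hpq) with h0 | h0
  · left
    rw [← Submodule.range_projection hpq, h0, LinearMap.range_zero]
  · right
    rw [← Submodule.ker_projection hpq, h0, LinearMap.ker_id]

theorem IsIndecomposableModule.isUnit_or_isNilpotent [IsArtinian R M] [IsNoetherian R M]
    (h : IsIndecomposableModule R M) (f : Module.End R M) : IsUnit f ∨ IsNilpotent f := by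
  obtain ⟨n, hn⟩ := Filter.eventually_atTop.1 f.eventually_isCompl_ker_pow_range_pow
  have hn' := hn (n + 1) n.le_succ
  rcases h.eq_bot_or_eq_bot hn' with h0 | h0
  · left
    rw [Module.End.isUnit_iff]
    refine IsArtinian.bijective_of_injective_endomorphism f fun x y hxy ↦
      LinearMap.ker_eq_bot.1 h0 ?_
    simp [pow_succ, hxy]
  · right
    exact ⟨n + 1, LinearMap.range_eq_bot.1 h0⟩

theorem IsIndecomposableModule.isNilpotent_iff [IsArtinian R M] [IsNoetherian R M]
    (h : IsIndecomposableModule R M) (f : Module.End R M) : IsNilpotent f ↔ ¬ IsUnit f := by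
  have := h.1
  refine ⟨fun hf hu ↦ ?_, fun hf ↦ (h.isUnit_or_isNilpotent f).resolve_left hf⟩
  obtain ⟨n, hn⟩ := hf
  exact not_isUnit_zero (hn ▸ hu.pow n)

theorem IsIndecomposableModule.isLocalRing [IsArtinian R M] [IsNoetherian R M]
    (h : IsIndecomposableModule R M) : IsLocalRing (Module.End R M) := by
  have := h.1
  exact IsLocalRing.of_isUnit_or_isUnit_one_sub_self fun a ↦
    (h.isUnit_or_isNilpotent a).imp_right fun h ↦ h.isUnit_one_sub

end Indecomposable

/-- A linear map `g : B → X` that is not a split epimorphism, but through which every map to `X`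
that is not a split epimorphism factors. -/
def IsRightAlmostSplit {R B X : Type u} [Ring R] [AddCommGroup B] [Module R B] [AddCommGroup X]
    [Module R X] (g : B →ₗ[R] X) : Prop :=
  (¬ ∃ s : X →ₗ[R] B, g ∘ₗ s = LinearMap.id) ∧
  ∀ (V : Type u) [AddCommGroup V] [Module R V] (h : V →ₗ[R] X),
    (¬ ∃ s : X →ₗ[R] V, h ∘ₗ s = LinearMap.id) → ∃ k : V →ₗ[R] B, g ∘ₗ k = h

theorem exists_functional_end {K R X E : Type u} [CommRing K] [Ring R] [Algebra K R]
    [AddCommGroup X] [Module R X] [Module K X] [IsScalarTower K R X] [AddCommGroup E] [Module K E]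
    [IsArtinian R X] [IsNoetherian R X]
    (hE : ∀ (V : Type u) [AddCommGroup V] [Module K V] (v : V), v ≠ 0 →
        ∃ f : V →ₗ[K] E, f v ≠ 0)
    (hX : IsIndecomposableModule R X) :
    ∃ c : (X →ₗ[R] X) →ₗ[K] E, c LinearMap.id ≠ 0 ∧
      ∀ f : X →ₗ[R] X, (¬ ∃ s : X →ₗ[R] X, f ∘ₗ s = LinearMap.id) → c f = 0 := by
  have := hX.1
  have := hX.isLocalRing
  let N : Submodule K (Module.End R X) :=
    { carrier := nonunits (Module.End R X)
      add_mem' := fun ha hb ↦ IsLocalRing.nonunits_add ha hb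
      zero_mem' := not_isUnit_zero
      smul_mem' := fun k f hf ↦ by
        rw [mem_nonunits_iff, ← hX.isNilpotent_iff] at hf ⊢
        exact hf.smul k }
  have h1 : N.mkQ 1 ≠ 0 := fun h ↦ by
    rw [Submodule.mkQ_apply, Submodule.Quotient.mk_eq_zero] at h
    exact h isUnit_one
  obtain ⟨f, hf⟩ := hE _ _ h1
  refine ⟨f ∘ₗ N.mkQ, hf, fun g hg ↦ ?_⟩
  have : g ∈ N := fun hu ↦ hg (by
    obtain ⟨u, hu⟩ := hu
    exact ⟨↑u⁻¹, by rw [← hu]; exact u.mul_inv⟩)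
  rw [LinearMap.comp_apply, Submodule.mkQ_apply, (Submodule.Quotient.mk_eq_zero N).2 this, map_zero]

/-- Finite presentation of a finitely generated module by generators `x` and relations `d`. -/
theorem exists_finite_presentation (R X : Type*) [Ring R] [IsNoetherianRing R] [AddCommGroup X]
    [Module R X] [Module.Finite R X] :
    ∃ (n m : ℕ) (x : Fin n → X) (d : Fin m → Fin n → R),
      Submodule.span R (Set.range x) = ⊤ ∧ (∀ i, ∑ j, d i j • x j = 0) ∧
      ∀ (V : Type u) [AddCommGroup V] [Module R V] (v : Fin n → V),
        (∀ i, ∑ j, d i j • v j = 0) → ∃ f : X →ₗ[R] V, ∀ j, f (x j) = v j := by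
  obtain ⟨n, π, hπ⟩ := Module.Finite.exists_fin' R X
  obtain ⟨m, ρ, hρ⟩ := Module.Finite.exists_fin' R (LinearMap.ker π)
  have hπ' : ∀ c : Fin n → R, π c = ∑ j, c j • π (Pi.single j 1) := fun c ↦ by
    conv_lhs => rw [pi_eq_sum_univ' c]
    simp
  refine ⟨n, m, fun j ↦ π (Pi.single j 1), fun i ↦ ρ (Pi.single i 1), ?_, fun i ↦ ?_, ?_⟩
  · rw [eq_top_iff]
    intro y _
    obtain ⟨c, rfl⟩ := hπ y
    rw [hπ']
    exact Submodule.sum_mem _ fun j _ ↦ Submodule.smul_mem _ _ (Submodule.subset_span ⟨j, rfl⟩)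
  · rw [← hπ']
    exact (ρ (Pi.single i 1)).2
  · intro V _ _ v hv
    let p : (Fin n → R) →ₗ[R] V := ∑ j, (LinearMap.toSpanSingleton R V (v j)) ∘ₗ LinearMap.proj j
    have hp : ∀ c, p c = ∑ j, c j • v j := fun c ↦ by simp [p]
    have hker : LinearMap.ker π ≤ LinearMap.ker p := by
      have h0 : p ∘ₗ (LinearMap.ker π).subtype ∘ₗ ρ = 0 := by
        refine LinearMap.pi_ext' fun i ↦ LinearMap.ext_ring ?_
        simpa [hp] using hv i
      intro c hc
      obtain ⟨b, hb⟩ := hρ ⟨c, hc⟩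
      have := LinearMap.congr_fun h0 b
      simpa [hb] using this
    let e := π.quotKerEquivOfSurjective hπ
    refine ⟨(LinearMap.ker π).liftQ p hker ∘ₗ e.symm, fun j ↦ ?_⟩
    have : e.symm (π (Pi.single j 1)) = Submodule.Quotient.mk (Pi.single j 1) := by
      rw [LinearEquiv.symm_apply_eq]; rfl
    simp [this, hp, Pi.single_apply]

theorem exists_finite_isRightAlmostSplit (K : Type u) {R X : Type u} [CommRing K]
    [IsArtinianRing K] [Ring R] [Algebra K R] [Module.Finite K R] [AddCommGroup X] [Module R X]
    [Module.Finite R X] (hX : IsIndecomposableModule R X) :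
    ∃ (B : Type u) (_ : AddCommGroup B) (_ : Module R B) (g : B →ₗ[R] X),
      Module.Finite R B ∧ IsRightAlmostSplit g := by
  have := IsArtinianRing.of_finite K R
  have := IsNoetherianRing.of_finite K R
  obtain ⟨E, _, _, hfin, hE, hsep⟩ := exists_finite_injective_cogenerator K
  let := moduleOfAlgebra K R X
  have := moduleOfAlgebra_isScalarTower K R X
  obtain ⟨c, hc1, hc⟩ := exists_functional_end (K := K) hsep hX
  obtain ⟨n, m, x, d, hx, hd, hpres⟩ := exists_finite_presentation.{u} R X
  let ev : (X →ₗ[R] X) →ₗ[K] (Fin n → X) :=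
    { toFun := fun f j ↦ f (x j)
      map_add' := fun _ _ ↦ rfl
      map_smul' := fun _ _ ↦ rfl }
  have hev : LinearMap.ker ev ≤ LinearMap.ker c := by
    intro f hf
    have : f = 0 := LinearMap.ext_on hx fun y ⟨j, hj⟩ ↦ by
      rw [← hj]; exact congrFun (LinearMap.mem_ker.1 hf) j
    simp [this]
  obtain ⟨c', hc'⟩ := hE.exists_comp_eq ev c hev
  have hc'' : ∀ f : X →ₗ[R] X, c' (fun j ↦ f (x j)) = c f := fun f ↦ LinearMap.congr_fun hc' f
  let B : Submodule R (X × (Fin m → Coinduced K R E)) :=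
    { carrier := {p | ∀ (j : Fin n) (s : R),
        ∑ i, (p.2 i).eval (d i j * s) = c' (Pi.single j (s • p.1))}
      add_mem' := fun {p q} hp hq j s ↦ by
        simp [Finset.sum_add_distrib, hp j s, hq j s, Pi.single_add]
      zero_mem' := fun j s ↦ by simp
      smul_mem' := fun r p hp j s ↦ by
        simpa [mul_assoc, mul_smul] using hp j (s * r) }
  let g : B →ₗ[R] X := LinearMap.fst R X _ ∘ₗ B.subtype
  refine ⟨B, inferInstance, inferInstance, g, inferInstance, ?_, ?_⟩
  · rintro ⟨s, hs⟩
    have hs' : ∀ y, (s y : X × (Fin m → Coinduced K R E)).1 = y := LinearMap.congr_fun hs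
    apply hc1
    rw [← hc'']
    have h1 : (fun j ↦ (LinearMap.id : X →ₗ[R] X) (x j)) = ∑ j, Pi.single j (x j) := by
      simp [Finset.univ_sum_single]
    rw [h1, map_sum]
    have h2 : ∀ j, c' (Pi.single j (x j)) =
        ∑ i, ((s (d i j • x j) : X × (Fin m → Coinduced K R E)).2 i).eval 1 := fun j ↦ by
      have := (s (x j)).2 j 1
      rw [hs', one_smul] at this
      rw [← this]
      simp
    simp_rw [h2]
    rw [Finset.sum_comm]
    refine Finset.sum_eq_zero fun i _ ↦ ?_
    let φ : X →+ E :=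
      { toFun := fun y ↦ ((s y : X × (Fin m → Coinduced K R E)).2 i).eval 1
        map_zero' := by simp
        map_add' := by simp }
    change ∑ j, φ (d i j • x j) = 0
    rw [← map_sum, hd, map_zero]
  · intro V _ _ h hh
    let := moduleOfAlgebra K R V
    have := moduleOfAlgebra_isScalarTower K R V
    let δ : (Fin n → V) →ₗ[K] (Fin m → V) :=
      { toFun := fun v i ↦ ∑ j, d i j • v j
        map_add' := fun v w ↦ by ext i; simp [Finset.sum_add_distrib]
        map_smul' := fun k v ↦ by
          ext i
          simp [Finset.smul_sum, smul_comm k] }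
    let τ : (Fin n → V) →ₗ[K] E := c' ∘ₗ
      { toFun := fun v j ↦ h (v j)
        map_add' := fun v w ↦ by ext i; simp
        map_smul' := fun k v ↦ by
          ext i
          exact map_smul h (algebraMap K R k) (v i) }
    have hker : LinearMap.ker δ ≤ LinearMap.ker τ := by
      intro v hv
      obtain ⟨f, hf⟩ := hpres V v fun i ↦ congrFun (LinearMap.mem_ker.1 hv) i
      have h1 : τ v = c (h ∘ₗ f) := by
        rw [← hc'']
        simp [τ, hf]
      rw [LinearMap.mem_ker, h1]
      exact hc _ fun ⟨s, hs⟩ ↦ hh ⟨f ∘ₗ s, hs⟩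
    obtain ⟨l, hl⟩ := hE.exists_comp_eq δ τ hker
    let k : V →ₗ[R] X × (Fin m → Coinduced K R E) :=
      h.prod (LinearMap.pi fun i ↦ Coinduced.lift (l ∘ₗ LinearMap.single K (fun _ ↦ V) i))
    refine ⟨k.codRestrict B fun v j s ↦ ?_, rfl⟩
    have h1 : ∑ i, ((k v).2 i).eval (d i j * s) = l (fun i ↦ (d i j * s) • v) := by
      change ∑ i, l (Pi.single i ((d i j * s) • v)) = _
      rw [← map_sum, Finset.univ_sum_single]
    have h2 : (fun i ↦ (d i j * s) • v) = δ (Pi.single j (s • v)) := by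
      ext i
      simp [δ, Pi.single_apply, mul_smul]
    rw [h1, h2, ← LinearMap.comp_apply, hl]
    change c' (fun j' ↦ h (Pi.single (M := fun _ ↦ V) j (s • v) j')) = c' (Pi.single j (s • h v))
    congr 1
    ext j'
    by_cases hj : j' = j
    · subst hj; simp
    · simp [hj]

theorem LinearMap.bijective_of_range_eq_top {R E : Type*} [Ring R] [AddCommGroup E] [Module R E]
    [IsNoetherian R E] (e : E →ₗ[R] E) (he : LinearMap.range e = ⊤) : Function.Bijective e :=
  ⟨IsNoetherian.injective_of_surjective_endomorphism e (LinearMap.range_eq_top.1 he),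
    LinearMap.range_eq_top.1 he⟩

/-- A minimal right almost split map: one that is moreover right minimal. -/
theorem exists_minimal_isRightAlmostSplit (K : Type u) {R X : Type u} [CommRing K]
    [IsArtinianRing K] [Ring R] [Algebra K R] [Module.Finite K R] [AddCommGroup X] [Module R X]
    [Module.Finite R X] (hX : IsIndecomposableModule R X)
    {B₀ : Type u} [AddCommGroup B₀] [Module R B₀] (g₀ : B₀ →ₗ[R] X)
    (hg₀ : Function.Surjective g₀) (hns : ¬ ∃ s : X →ₗ[R] B₀, g₀ ∘ₗ s = LinearMap.id) :
    ∃ (B : Type u) (_ : AddCommGroup B) (_ : Module R B) (g : B →ₗ[R] X),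
      Module.Finite R B ∧ IsRightAlmostSplit g ∧ Function.Surjective g ∧
      ∀ e : B →ₗ[R] B, g ∘ₗ e = g → Function.Bijective e := by
  have := IsArtinianRing.of_finite K R
  have := IsNoetherianRing.of_finite K R
  obtain ⟨B, _, _, g, _, hg⟩ := exists_finite_isRightAlmostSplit K hX
  obtain ⟨U, hU, hmin⟩ := IsArtinian.set_has_minimal
    {U : Submodule R B | IsRightAlmostSplit (g ∘ₗ U.subtype)}
    ⟨⊤, fun ⟨s, hs⟩ ↦ hg.1 ⟨(⊤ : Submodule R B).subtype ∘ₗ s, hs⟩, fun V _ _ h hh ↦ by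
      obtain ⟨k, hk⟩ := hg.2 V h hh
      exact ⟨k.codRestrict ⊤ fun _ ↦ trivial, hk⟩⟩
  have hU' : IsRightAlmostSplit (g ∘ₗ U.subtype) := hU
  refine ⟨U, inferInstance, inferInstance, g ∘ₗ U.subtype, inferInstance, hU, ?_, fun e he ↦ ?_⟩
  · obtain ⟨k, hk⟩ := hU'.2 B₀ g₀ hns
    intro x
    obtain ⟨b, rfl⟩ := hg₀ x
    exact ⟨k b, LinearMap.congr_fun hk b⟩
  · refine LinearMap.bijective_of_range_eq_top e ?_
    have he' : ∀ u : U, g (e u) = g u := LinearMap.congr_fun he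
    let U' : Submodule R B := (LinearMap.range e).map U.subtype
    have hle : U' ≤ U := Submodule.map_subtype_le _ _
    have hmem : ∀ u : U, (e u : B) ∈ U' := fun u ↦ ⟨e u, ⟨u, rfl⟩, rfl⟩
    have hU'U : U' = U := by
      refine (eq_or_lt_of_le hle).resolve_right fun hlt ↦ hmin U' ⟨fun ⟨s, hs⟩ ↦ hg.1
        ⟨U'.subtype ∘ₗ s, hs⟩, fun V _ _ h hh ↦ ?_⟩ hlt
      obtain ⟨k, hk⟩ := hU'.2 V h hh
      refine ⟨(U.subtype ∘ₗ e ∘ₗ k).codRestrict U' fun v ↦ hmem _, ?_⟩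
      ext v
      exact (he' _).trans (LinearMap.congr_fun hk v)
    rw [eq_top_iff]
    intro u _
    have hu : (u : B) ∈ U' := by
      rw [hU'U]
      exact u.2
    obtain ⟨w, hw, hwu⟩ := hu
    rwa [← Subtype.ext (hwu : (w : B) = u)]

/-- Pushout of a short exact sequence. -/
theorem exists_pushout {R : Type*} {T V E X : Type u} [Ring R] [AddCommGroup T] [Module R T]
    [AddCommGroup V] [Module R V] [AddCommGroup E] [Module R E] [AddCommGroup X] [Module R X]
    (d : T →ₗ[R] E) (φ : T →ₗ[R] V) (g : E →ₗ[R] X) (hg : Function.Surjective g)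
    (hdg : LinearMap.range d = LinearMap.ker g) :
    ∃ (B : Type u) (_ : AddCommGroup B) (_ : Module R B) (jV : V →ₗ[R] B) (jE : E →ₗ[R] B)
      (q : B →ₗ[R] X), q ∘ₗ jE = g ∧ Function.Surjective q ∧
      (∀ t, jV (φ t) = jE (d t)) ∧ LinearMap.range jV = LinearMap.ker q ∧
      ∀ v, jV v = 0 → ∃ t, d t = 0 ∧ φ t = v := by
  let S : Submodule R (V × E) := LinearMap.range (φ.prod (-d))
  have hgd : ∀ t, g (d t) = 0 := fun t ↦ LinearMap.mem_ker.1 (hdg ▸ ⟨t, rfl⟩)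
  let q : (V × E) ⧸ S →ₗ[R] X := S.liftQ (g ∘ₗ LinearMap.snd R V E) (by
    rintro _ ⟨t, rfl⟩
    simp [hgd])
  have hq : ∀ v e, q (S.mkQ (v, e)) = g e := fun v e ↦ by simp [q]
  have hrel : ∀ t, S.mkQ (φ t, 0) = S.mkQ (0, d t) := fun t ↦ by
    rw [← sub_eq_zero, ← map_sub, Submodule.mkQ_apply, Submodule.Quotient.mk_eq_zero]
    exact ⟨t, by simp⟩
  refine ⟨(V × E) ⧸ S, inferInstance, inferInstance, S.mkQ ∘ₗ LinearMap.inl R V E,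
    S.mkQ ∘ₗ LinearMap.inr R V E, q, ?_, ?_, hrel, ?_, ?_⟩
  · ext e
    exact hq 0 e
  · intro x
    obtain ⟨e, rfl⟩ := hg x
    exact ⟨S.mkQ (0, e), hq 0 e⟩
  · ext b
    constructor
    · rintro ⟨v, rfl⟩
      exact (hq v 0).trans (map_zero g)
    · intro hb
      obtain ⟨⟨v, e⟩, rfl⟩ := S.mkQ_surjective b
      rw [LinearMap.mem_ker, hq, ← LinearMap.mem_ker, ← hdg] at hb
      obtain ⟨t, rfl⟩ := hb
      refine ⟨v + φ t, ?_⟩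
      have h1 : ((v, d t) : V × E) = (v, 0) + (0, d t) := by simp
      have h2 : ((v + φ t, 0) : V × E) = (v, 0) + (φ t, 0) := by simp
      change S.mkQ (v + φ t, 0) = S.mkQ (v, d t)
      rw [h1, map_add, ← hrel, ← map_add, ← h2]
  · intro v hv
    have : ((v, 0) : V × E) ∈ S := (Submodule.Quotient.mk_eq_zero S).1 hv
    obtain ⟨t, ht⟩ := this
    have h1 := congrArg Prod.fst ht
    have h2 := congrArg Prod.snd ht
    exact ⟨t, by simpa using h2, by simpa using h1⟩

/-- Every non-split monomorphism from the kernel of a right minimal, right almost split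
epimorphism extends to the middle term. -/
theorem IsRightAlmostSplit.exists_extension {R E X V : Type u} [Ring R] [AddCommGroup E]
    [Module R E] [AddCommGroup X] [Module R X] [AddCommGroup V] [Module R V] {g : E →ₗ[R] X}
    (hg : IsRightAlmostSplit g) (hs : Function.Surjective g)
    (hmin : ∀ e : E →ₗ[R] E, g ∘ₗ e = g → Function.Bijective e)
    (h : LinearMap.ker g →ₗ[R] V)
    (hh : ¬ ∃ r : V →ₗ[R] LinearMap.ker g, r ∘ₗ h = LinearMap.id) :
    ∃ k : E →ₗ[R] V, k ∘ₗ (LinearMap.ker g).subtype = h := by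
  obtain ⟨B, _, _, jV, jE, q, hqE, hq, hcomm, hrange, hker⟩ :=
    exists_pushout (LinearMap.ker g).subtype h g hs (Submodule.range_subtype _)
  have hqE' : ∀ e, q (jE e) = g e := LinearMap.congr_fun hqE
  have hqV : ∀ v, q (jV v) = 0 := fun v ↦ LinearMap.mem_ker.1 (hrange ▸ ⟨v, rfl⟩)
  by_cases hsplit : ∃ s : X →ₗ[R] B, q ∘ₗ s = LinearMap.id
  · obtain ⟨s, hs'⟩ := hsplit
    have hinj : Function.Injective jV := by
      rw [← LinearMap.ker_eq_bot, LinearMap.ker_eq_bot']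
      intro v hv
      obtain ⟨t, ht, rfl⟩ := hker v hv
      rw [show t = 0 from Subtype.ext ht, map_zero]
    let e := LinearEquiv.ofInjective jV hinj
    let m : E →ₗ[R] LinearMap.range jV := (jE - s ∘ₗ g).codRestrict _ fun y ↦ by
      rw [hrange, LinearMap.mem_ker]
      have := LinearMap.congr_fun hs' (g y)
      simp only [LinearMap.comp_apply, LinearMap.id_apply] at this
      simp [hqE', this]
    refine ⟨e.symm ∘ₗ m, LinearMap.ext fun t ↦ ?_⟩
    simp only [LinearMap.comp_apply, LinearEquiv.coe_coe]
    rw [LinearEquiv.symm_apply_eq]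
    apply Subtype.ext
    change jE t - s (g t) = jV (h t)
    rw [hcomm, LinearMap.mem_ker.1 t.2, map_zero, sub_zero]
    rfl
  · exfalso
    obtain ⟨k, hk⟩ := hg.2 B q hsplit
    have hk' : ∀ b, g (k b) = q b := LinearMap.congr_fun hk
    have hge : g ∘ₗ (k ∘ₗ jE) = g := LinearMap.ext fun y ↦ by simp [hk', hqE']
    let e := LinearEquiv.ofBijective _ (hmin _ hge)
    have hge' : ∀ y, g (e.symm y) = g y := fun y ↦ by
      conv_rhs => rw [← e.apply_symm_apply y]
      exact (LinearMap.congr_fun hge _).symm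
    apply hh
    refine ⟨((e.symm : E →ₗ[R] E) ∘ₗ k ∘ₗ jV).codRestrict _ fun v ↦ ?_, LinearMap.ext fun t ↦ ?_⟩
    · simp [hge', hk', hqV]
    · apply Subtype.ext
      change e.symm (k (jV (h t))) = t
      rw [hcomm, LinearEquiv.symm_apply_eq]
      rfl

theorem IsRightAlmostSplit.isIndecomposableModule_ker {R E X : Type u} [Ring R] [AddCommGroup E]
    [Module R E] [AddCommGroup X] [Module R X] {g : E →ₗ[R] X}
    (hg : IsRightAlmostSplit g) (hs : Function.Surjective g)
    (hmin : ∀ e : E →ₗ[R] E, g ∘ₗ e = g → Function.Bijective e) :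
    IsIndecomposableModule R (LinearMap.ker g) := by
  refine ⟨?_, fun π hπ ↦ ?_⟩
  · rw [Submodule.nontrivial_iff_ne_bot]
    intro h0
    let e := LinearEquiv.ofBijective g ⟨LinearMap.ker_eq_bot.1 h0, hs⟩
    exact hg.1 ⟨e.symm, LinearMap.ext fun x ↦ e.apply_symm_apply x⟩
  · have hπ' : ∀ t, π (π t) = π t := LinearMap.congr_fun hπ
    by_contra! hne
    have h1 : ¬ ∃ r, r ∘ₗ π = LinearMap.id := fun ⟨r, hr⟩ ↦ hne.2 <| by
      have hr' : ∀ t, r (π t) = t := LinearMap.congr_fun hr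
      ext1 t
      have := hr' (π t)
      rw [hπ', hr'] at this
      exact this.symm
    have h2 : ¬ ∃ r, r ∘ₗ (LinearMap.id - π) = LinearMap.id := fun ⟨r, hr⟩ ↦ hne.1 <| by
      ext1 t
      have := LinearMap.congr_fun hr (π t)
      simpa [hπ'] using this.symm
    obtain ⟨k₁, hk₁⟩ := hg.exists_extension hs hmin π h1
    obtain ⟨k₂, hk₂⟩ := hg.exists_extension hs hmin _ h2
    have hk : ∀ t : LinearMap.ker g, (k₁ + k₂) (t : E) = t := fun t ↦ by
      have a := LinearMap.congr_fun hk₁ t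
      have b := LinearMap.congr_fun hk₂ t
      simp only [LinearMap.comp_apply, Submodule.subtype_apply] at a b
      simp [a, b]
    let p : E →ₗ[R] E := LinearMap.id - (LinearMap.ker g).subtype ∘ₗ (k₁ + k₂)
    have hp : LinearMap.ker g ≤ LinearMap.ker p := fun t ht ↦ by
      have := congrArg Subtype.val (hk ⟨t, ht⟩)
      rw [LinearMap.mem_ker]
      change t - ((k₁ + k₂) t : E) = 0
      rw [sub_eq_zero]
      exact this.symm
    let e := g.quotKerEquivOfSurjective hs
    refine hg.1 ⟨(LinearMap.ker g).liftQ p hp ∘ₗ e.symm, LinearMap.ext fun x ↦ ?_⟩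
    obtain ⟨y, rfl⟩ := hs x
    have : e.symm (g y) = Submodule.Quotient.mk y := by
      rw [LinearEquiv.symm_apply_eq]; rfl
    have h3 : g ((k₁ + k₂) y : E) = 0 := LinearMap.mem_ker.1 ((k₁ + k₂) y).2
    simp only [LinearMap.comp_apply, LinearEquiv.coe_coe, this, Submodule.liftQ_apply, p,
      LinearMap.sub_apply, map_sub, Submodule.subtype_apply, h3, LinearMap.id_apply, sub_zero]

theorem LinearMap.exists_comp_eq_of_surjective {R M N P : Type*} [Ring R] [AddCommGroup M]
    [Module R M] [AddCommGroup N] [Module R N] [AddCommGroup P] [Module R P] (π : M →ₗ[R] N)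
    (hπ : Function.Surjective π) (k : M →ₗ[R] P) (h : LinearMap.ker π ≤ LinearMap.ker k) :
    ∃ l : N →ₗ[R] P, l ∘ₗ π = k := by
  refine ⟨(LinearMap.ker π).liftQ k h ∘ₗ (π.quotKerEquivOfSurjective hπ).symm,
    LinearMap.ext fun x ↦ ?_⟩
  have : (π.quotKerEquivOfSurjective hπ).symm (π x) = Submodule.Quotient.mk x := by
    rw [LinearEquiv.symm_apply_eq]; rfl
  simp [this]

/-- There are nonzero maps `X → M → ker g` for some right minimal, right almost split epimorphism
`g` ending at a finitely generated indecomposable module `X`. -/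
def IsShortChainMiddle (R M : Type u) [Ring R] [AddCommGroup M] [Module R M] : Prop :=
  ∃ (X E : Type u) (_ : AddCommGroup X) (_ : Module R X) (_ : AddCommGroup E) (_ : Module R E)
    (g : E →ₗ[R] X), Module.Finite R X ∧ IsIndecomposableModule R X ∧ IsRightAlmostSplit g ∧
    Function.Surjective g ∧ (∀ e : E →ₗ[R] E, g ∘ₗ e = g → Function.Bijective e) ∧
    (∃ u : X →ₗ[R] M, u ≠ 0) ∧ ∃ v : M →ₗ[R] LinearMap.ker g, v ≠ 0

theorem IsShortChainMiddle.of_not_lift (K : Type u) {R X M B C : Type u} [CommRing K]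
    [IsArtinianRing K] [Ring R] [Algebra K R] [Module.Finite K R] [AddCommGroup X] [Module R X]
    [Module.Finite R X] [AddCommGroup M] [Module R M] [AddCommGroup B] [Module R B]
    [AddCommGroup C] [Module R C] (hX : IsIndecomposableModule R X) (a : M →ₗ[R] B)
    (q : B →ₗ[R] C) (hq : Function.Surjective q) (haq : LinearMap.range a = LinearMap.ker q)
    (h : X →ₗ[R] C) (hh : ¬ ∃ k : X →ₗ[R] B, q ∘ₗ k = h) (u : X →ₗ[R] M) (hu : u ≠ 0) :
    IsShortChainMiddle R M := by
  let W : Submodule R (B × X) :=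
    LinearMap.ker (q ∘ₗ LinearMap.fst R B X - h ∘ₗ LinearMap.snd R B X)
  have hW : ∀ w : B × X, w ∈ W ↔ q w.1 = h w.2 := fun w ↦ by simp [W, sub_eq_zero]
  have hqa : ∀ m, q (a m) = 0 := fun m ↦ LinearMap.mem_ker.1 (haq ▸ ⟨m, rfl⟩)
  let π : W →ₗ[R] X := LinearMap.snd R B X ∘ₗ W.subtype
  have hπ : Function.Surjective π := fun x ↦ by
    obtain ⟨b, hb⟩ := hq (h x)
    exact ⟨⟨(b, x), (hW _).2 hb⟩, rfl⟩
  have hns : ¬ ∃ s : X →ₗ[R] W, π ∘ₗ s = LinearMap.id := fun ⟨s, hs⟩ ↦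
    hh ⟨LinearMap.fst R B X ∘ₗ W.subtype ∘ₗ s, LinearMap.ext fun x ↦ by
      have h1 : (s x : B × X).2 = x := LinearMap.congr_fun hs x
      have h2 := (hW _).1 (s x).2
      rw [h1] at h2
      exact h2⟩
  obtain ⟨E, _, _, g, _, hg, hgs, hmin⟩ := exists_minimal_isRightAlmostSplit K hX π hπ hns
  obtain ⟨k, hk⟩ := hg.2 W π hns
  have hk' : ∀ w, g (k w) = (w : B × X).2 := LinearMap.congr_fun hk
  let a' : M →ₗ[R] W := (LinearMap.inl R B X ∘ₗ a).codRestrict W fun m ↦ (hW _).2 (by simp [hqa])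
  refine ⟨X, E, _, _, _, _, g, inferInstance, hX, hg, hgs, hmin, ⟨u, hu⟩,
    (k ∘ₗ a').codRestrict _ fun m ↦ ?_, fun h0 ↦ ?_⟩
  · rw [LinearMap.mem_ker]
    exact hk' _
  · have hker : LinearMap.ker π ≤ LinearMap.ker k := by
      rintro ⟨⟨b, x⟩, hw⟩ hx
      obtain rfl : x = 0 := hx
      have hb : b ∈ LinearMap.ker q := by
        have := (hW _).1 hw
        rw [LinearMap.mem_ker, this, map_zero]
      rw [← haq] at hb
      obtain ⟨m, rfl⟩ := hb
      exact congrArg Subtype.val (LinearMap.congr_fun h0 m)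
    obtain ⟨l, hl⟩ := π.exists_comp_eq_of_surjective hπ k hker
    refine hg.1 ⟨l, (LinearMap.cancel_right hπ).1 ?_⟩
    rw [LinearMap.comp_assoc, hl, hk]
    rfl

theorem exists_indecomposable_submodule {R C : Type*} [Ring R] [AddCommGroup C] [Module R C]
    [IsArtinian R C] (Q : Submodule R C → Prop) (hbot : ¬ Q ⊥) (htop : Q ⊤)
    (hQ : ∀ X₁ X₂, Disjoint X₁ X₂ → Q (X₁ ⊔ X₂) → Q X₁ ∨ Q X₂) :
    ∃ X : Submodule R C, Q X ∧ IsIndecomposableModule R X := by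
  obtain ⟨X, hX, hmin⟩ := IsArtinian.set_has_minimal {X | Q X} ⟨⊤, htop⟩
  have hmin' : ∀ p : Submodule R X, Q (p.map X.subtype) → p = ⊤ := fun p hp ↦ by
    have h1 := (eq_or_lt_of_le (Submodule.map_subtype_le X p)).resolve_right (hmin _ hp)
    refine Submodule.map_injective_of_injective X.subtype_injective ?_
    rw [h1, Submodule.map_subtype_top]
  refine ⟨X, hX, ?_, fun e he ↦ ?_⟩
  · rw [Submodule.nontrivial_iff_ne_bot]
    rintro rfl
    exact hbot hX
  · have hc : IsCompl (LinearMap.range e) (LinearMap.ker e) :=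
      LinearMap.IsIdempotentElem.isCompl he
    have h1 : Q ((LinearMap.range e).map X.subtype ⊔ (LinearMap.ker e).map X.subtype) := by
      rwa [← Submodule.map_sup, hc.sup_eq_top, Submodule.map_subtype_top]
    have he' : ∀ x, e (e x) = e x := LinearMap.congr_fun he
    rcases hQ _ _ (Submodule.disjoint_map X.subtype_injective hc.disjoint) h1 with h2 | h2
    · right
      ext1 x
      obtain ⟨y, rfl⟩ := LinearMap.range_eq_top.1 (hmin' _ h2) x
      exact he' y
    · left
      exact LinearMap.ker_eq_top.1 (hmin' _ h2)

/-- A nonzero map `g : M → N` into an indecomposable followed by a nonzero map `f : N → M` with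
zero composite makes `M` the middle of a short chain. -/
theorem IsShortChainMiddle.of_comp_eq_zero (K : Type u) {R M N : Type u} [CommRing K]
    [IsArtinianRing K] [Ring R] [Algebra K R] [Module.Finite K R] [AddCommGroup M] [Module R M]
    [AddCommGroup N] [Module R N] [Module.Finite R N] (hN : IsIndecomposableModule R N)
    {g : M →ₗ[R] N} (hg : g ≠ 0) {f : N →ₗ[R] M} (hf : f ≠ 0) (hfg : f ∘ₗ g = 0) :
    IsShortChainMiddle R M := by
  have := IsArtinianRing.of_finite K R
  have := IsNoetherianRing.of_finite K R
  let C := N ⧸ LinearMap.range g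
  let q : N →ₗ[R] C := (LinearMap.range g).mkQ
  have hq : Function.Surjective q := Submodule.mkQ_surjective _
  let F : C →ₗ[R] M := (LinearMap.range g).liftQ f (by
    rintro _ ⟨m, rfl⟩
    exact LinearMap.congr_fun hfg m)
  have hF : F ∘ₗ q = f := Submodule.liftQ_mkQ _ _ _
  have hF0 : F ≠ 0 := by
    rintro h
    rw [h, LinearMap.zero_comp] at hF
    exact hf hF.symm
  obtain ⟨X, ⟨⟨Y, hXY⟩, hX⟩, hXi⟩ := exists_indecomposable_submodule
    (fun X : Submodule R C ↦ (∃ Y, IsCompl X Y) ∧ F ∘ₗ X.subtype ≠ 0)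
    (fun ⟨_, h⟩ ↦ h (LinearMap.ext fun x ↦ by rw [Subsingleton.elim x 0, map_zero, map_zero]))
    ⟨⟨⊥, isCompl_top_bot⟩, fun h ↦ hF0 (LinearMap.ext fun x ↦ LinearMap.congr_fun h ⟨x, trivial⟩)⟩
    (by
      rintro X₁ X₂ hd ⟨⟨Y, hY⟩, h⟩
      by_cases h1 : F ∘ₗ X₁.subtype = 0
      · refine Or.inr ⟨⟨X₁ ⊔ Y, ?_, ?_⟩, fun h2 ↦ h (LinearMap.ext ?_)⟩
        · exact hd.symm.disjoint_sup_right_of_disjoint_sup_left (sup_comm X₁ X₂ ▸ hY.disjoint)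
        · rw [codisjoint_iff, ← sup_assoc, sup_comm X₂]
          exact hY.sup_eq_top
        · rintro ⟨x, hx⟩
          obtain ⟨y, hy, z, hz, rfl⟩ := Submodule.mem_sup.1 hx
          have h3 : F y = 0 := LinearMap.congr_fun h1 ⟨y, hy⟩
          have h4 : F z = 0 := LinearMap.congr_fun h2 ⟨z, hz⟩
          simp [h3, h4]
      · refine Or.inl ⟨⟨X₂ ⊔ Y, ?_, ?_⟩, h1⟩
        · exact hd.disjoint_sup_right_of_disjoint_sup_left hY.disjoint
        · rw [codisjoint_iff, ← sup_assoc]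
          exact hY.sup_eq_top)
  refine .of_not_lift K hXi g q hq (Submodule.ker_mkQ _).symm X.subtype ?_ _ hX
  rintro ⟨s, hs⟩
  let r : C →ₗ[R] X := Submodule.projectionOnto X Y hXY
  have hr : ∀ x : X, r x = x := Submodule.projectionOnto_apply_left hXY
  have hs' : ∀ x : X, q (s x) = x := LinearMap.congr_fun hs
  rcases hN.2 (s ∘ₗ r ∘ₗ q) (LinearMap.ext fun n ↦ by simp [hs', hr]) with h0 | h0
  · apply hX
    ext x
    obtain ⟨n, hn⟩ := hq x
    have h1 : s (r (q n)) = 0 := LinearMap.congr_fun h0 n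
    have h2 := hs' (r (q n))
    rw [h1, map_zero, hn, hr] at h2
    simp [← h2]
  · apply hg
    ext m
    have h1 : s (r (q (g m))) = g m := LinearMap.congr_fun h0 (g m)
    have h2 : q (g m) = 0 := (Submodule.Quotient.mk_eq_zero _).2 ⟨m, rfl⟩
    rw [← h1, h2]
    simp

theorem LinearMap.exists_isCompl_ker_range_pow_succ {R M : Type*} [Ring R] [AddCommGroup M]
    [Module R M] [IsArtinian R M] [IsNoetherian R M] (e : Module.End R M) :
    ∃ n : ℕ, IsCompl (LinearMap.range (e ^ (n + 1))) (LinearMap.ker (e ^ (n + 1))) := by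
  obtain ⟨n, hn⟩ := Filter.eventually_atTop.1 e.eventually_isCompl_ker_pow_range_pow
  exact ⟨n, (hn (n + 1) n.le_succ).symm⟩

theorem exists_projective_cover {R M : Type u} [Ring R] [IsArtinianRing R] [AddCommGroup M]
    [Module R M] [Module.Finite R M] :
    ∃ (P : Type u) (_ : AddCommGroup P) (_ : Module R P) (ρ : P →ₗ[R] M), Module.Finite R P ∧
      Module.Projective R P ∧ Function.Surjective ρ ∧
      ∀ U : Submodule R P, LinearMap.ker ρ ⊔ U = ⊤ → U = ⊤ := by
  obtain ⟨m, ρ, hρ⟩ := Module.Finite.exists_fin' R M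
  obtain ⟨P, ⟨hP, hs⟩, hmin⟩ := IsArtinian.set_has_minimal
    {U : Submodule R (Fin m → R) | Module.Projective R U ∧ Function.Surjective (ρ ∘ₗ U.subtype)}
    ⟨⊤, .of_equiv Submodule.topEquiv.symm, fun x ↦ by
      obtain ⟨y, rfl⟩ := hρ x
      exact ⟨⟨y, trivial⟩, rfl⟩⟩
  refine ⟨P, inferInstance, inferInstance, ρ ∘ₗ P.subtype, inferInstance, hP, hs, fun U hU ↦ ?_⟩
  have hUs : Function.Surjective (ρ ∘ₗ P.subtype ∘ₗ U.subtype) := fun x ↦ by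
    obtain ⟨p, rfl⟩ := hs x
    obtain ⟨l, hl, u, hu, rfl⟩ := Submodule.mem_sup.1 (hU ▸ Submodule.mem_top : p ∈ _ ⊔ U)
    refine ⟨⟨u, hu⟩, ?_⟩
    rw [map_add, LinearMap.mem_ker.1 hl, zero_add]
    rfl
  obtain ⟨k, hk⟩ := Module.projective_lifting_property _ (ρ ∘ₗ P.subtype) hUs
  let e : Module.End R P := U.subtype ∘ₗ k
  have he : ∀ p, ρ (e p) = ρ p := LinearMap.congr_fun hk
  obtain ⟨n, hn⟩ := LinearMap.exists_isCompl_ker_range_pow_succ e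
  have hen : ∀ j : ℕ, ∀ p, ρ ((e ^ j) p) = ρ p := fun j ↦ by
    induction j with
    | zero => simp
    | succ j ih => intro p; rw [pow_succ, Module.End.mul_apply, ih, he]
  set S := LinearMap.range (e ^ (n + 1)) with hS
  have hproj : Module.Projective R S :=
    .of_split S.subtype (Submodule.projectionOnto S _ hn)
      (LinearMap.ext fun x ↦ Submodule.projectionOnto_apply_left hn x)
  have hST : S = ⊤ := by
    have h1 := (eq_or_lt_of_le (Submodule.map_subtype_le P S)).resolve_right (hmin _
      ⟨.of_equiv (Submodule.equivMapOfInjective _ P.subtype_injective S), fun x ↦ by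
        obtain ⟨p, rfl⟩ := hs x
        exact ⟨⟨(e ^ (n + 1)) p, _, ⟨p, rfl⟩, rfl⟩, hen _ p⟩⟩)
    refine Submodule.map_injective_of_injective P.subtype_injective ?_
    rw [h1, Submodule.map_subtype_top]
  rw [eq_top_iff, ← hST, hS]
  rintro _ ⟨p, rfl⟩
  rw [pow_succ', Module.End.mul_apply]
  exact (k _).2

theorem exists_injective_hull (K : Type u) {R J : Type u} [CommRing K] [IsArtinianRing K]
    [Ring R] [Algebra K R] [Module.Finite K R] [AddCommGroup J] [Module R J] [Module.Finite R J] :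
    ∃ (I : Type u) (_ : AddCommGroup I) (_ : Module R I) (i : J →ₗ[R] I), Module.Finite R I ∧
      Module.Baer R I ∧ Function.Injective i ∧
      ∀ U : Submodule R I, LinearMap.range i ⊓ U = ⊥ → U = ⊥ := by
  have := IsArtinianRing.of_finite K R
  have := IsNoetherianRing.of_finite K R
  obtain ⟨I', _, _, i', _, hI', hi'⟩ := exists_finite_baer_embedding K (R := R) J
  obtain ⟨I, ⟨hI, hiI⟩, hmin⟩ := IsArtinian.set_has_minimal
    {U : Submodule R I' | Module.Baer R U ∧ LinearMap.range i' ≤ U}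
    ⟨⊤, hI'.of_retract (Submodule.subtype ⊤) Submodule.topEquiv.symm.toLinearMap fun _ ↦ rfl, le_top⟩
  let i : J →ₗ[R] I := i'.codRestrict I fun j ↦ hiI ⟨j, rfl⟩
  have hi : Function.Injective i := fun x y h ↦ hi' (congrArg Subtype.val h)
  refine ⟨I, inferInstance, inferInstance, i, inferInstance, hI, hi, fun U hU ↦ ?_⟩
  have hinj : Function.Injective (U.mkQ ∘ₗ i) := by
    rw [← LinearMap.ker_eq_bot, LinearMap.ker_eq_bot']
    intro j hj
    have h1 : i j ∈ U := (Submodule.Quotient.mk_eq_zero U).1 hj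
    have h2 : i j ∈ (⊥ : Submodule R I) := hU ▸ ⟨⟨j, rfl⟩, h1⟩
    exact hi (by rw [(Submodule.mem_bot R).1 h2, map_zero])
  obtain ⟨k, hk⟩ := hI.extension_property _ hinj i
  let e : Module.End R I := k ∘ₗ U.mkQ
  have he : ∀ j, e (i j) = i j := LinearMap.congr_fun hk
  obtain ⟨n, hn⟩ := LinearMap.exists_isCompl_ker_range_pow_succ e
  have hen : ∀ t : ℕ, ∀ j, (e ^ t) (i j) = i j := fun t ↦ by
    induction t with
    | zero => simp
    | succ t ih => intro j; rw [pow_succ, Module.End.mul_apply, he, ih]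
  set S := LinearMap.range (e ^ (n + 1)) with hS
  have hB : Module.Baer R S := hI.of_retract S.subtype (Submodule.projectionOnto S _ hn)
    fun x ↦ Submodule.projectionOnto_apply_left hn x
  have hST : S = ⊤ := by
    let eq := Submodule.equivMapOfInjective _ I.subtype_injective S
    have h1 := (eq_or_lt_of_le (Submodule.map_subtype_le I S)).resolve_right (hmin _
      ⟨hB.of_retract eq.symm.toLinearMap eq.toLinearMap fun x ↦ eq.apply_symm_apply x, by
        rintro _ ⟨j, rfl⟩
        exact ⟨i j, ⟨i j, hen _ j⟩, rfl⟩⟩)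
    refine Submodule.map_injective_of_injective I.subtype_injective ?_
    rw [h1, Submodule.map_subtype_top]
  have hes : Function.Bijective e := LinearMap.bijective_of_range_eq_top e <| by
    rw [eq_top_iff, ← hST, hS]
    rintro _ ⟨p, rfl⟩
    rw [pow_succ', Module.End.mul_apply]
    exact ⟨_, rfl⟩
  rw [eq_bot_iff]
  intro u hu
  have : e u = 0 := by
    change k (U.mkQ u) = 0
    rw [Submodule.mkQ_apply, (Submodule.Quotient.mk_eq_zero U).2 hu, map_zero]
  exact (Submodule.mem_bot R).2 (hes.1 (by rw [this, map_zero]))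

/-- If `P₁ → P₀ → M → 0` is exact with `P₁` a cover of its image and `M` is not the middle of a
short chain, then `Hom(P₀, M) → Hom(P₁, M)` is surjective. -/
theorem exists_extend_of_not_isShortChainMiddle (K : Type u) {R M P₀ P₁ : Type u} [CommRing K]
    [IsArtinianRing K] [Ring R] [Algebra K R] [Module.Finite K R] [AddCommGroup M] [Module R M]
    [Module.Finite R M] (hM : IsIndecomposableModule R M) (hmid : ¬ IsShortChainMiddle R M)
    [AddCommGroup P₀] [Module R P₀] [Module.Projective R P₀] [AddCommGroup P₁] [Module R P₁]
    (π : P₀ →ₗ[R] M) (hπ : Function.Surjective π) (d : P₁ →ₗ[R] P₀)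
    (hd : LinearMap.range d = LinearMap.ker π)
    (hcov : ∀ U : Submodule R P₁, LinearMap.ker d ⊔ U = ⊤ → U = ⊤) (φ : P₁ →ₗ[R] M) :
    ∃ ψ : P₀ →ₗ[R] M, ψ ∘ₗ d = φ := by
  obtain ⟨B, _, _, jV, jE, q, hqE, hq, hcomm, hrange, hker⟩ := exists_pushout d φ π hπ hd
  have hqE' : ∀ e, q (jE e) = π e := LinearMap.congr_fun hqE
  by_cases hsplit : ∃ s : M →ₗ[R] B, q ∘ₗ s = LinearMap.id
  · obtain ⟨s, hs⟩ := hsplit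
    have hs' : ∀ x, q (s x) = x := LinearMap.congr_fun hs
    obtain ⟨ψ, hψ⟩ := Module.projective_lifting_property jV.rangeRestrict
      ((jE - s ∘ₗ π).codRestrict (LinearMap.range jV) fun p ↦ by
        rw [hrange, LinearMap.mem_ker]
        simp [hqE', hs']) jV.surjective_rangeRestrict
    have hψ' : ∀ p, jV (ψ p) = jE p - s (π p) := fun p ↦
      congrArg Subtype.val (LinearMap.congr_fun hψ p)
    have hπd : ∀ t, π (d t) = 0 := fun t ↦ LinearMap.mem_ker.1 (hd ▸ ⟨t, rfl⟩)
    refine ⟨ψ, ?_⟩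
    have h0 : LinearMap.ker (φ - ψ ∘ₗ d) = ⊤ := hcov _ <| by
      rw [eq_top_iff]
      intro t _
      have h1 : jV ((φ - ψ ∘ₗ d) t) = 0 := by simp [hψ', hcomm, hπd]
      obtain ⟨t', ht', h2⟩ := hker _ h1
      refine Submodule.mem_sup.2 ⟨t', ht', t - t', ?_, by simp⟩
      rw [LinearMap.mem_ker, map_sub, ← h2]
      simp [ht']
    exact (sub_eq_zero.1 (LinearMap.ker_eq_top.1 h0)).symm
  · have := hM.1
    exact absurd (.of_not_lift K hM jV q hq hrange LinearMap.id hsplit LinearMap.id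
      (one_ne_zero (α := Module.End R M))) hmid

/-- If `0 → M → I₀ → I₁` is exact with `I₁` an essential extension of the cokernel of `M → I₀` and
`M` is not the middle of a short chain, then `Hom(M, I₀) → Hom(M, I₁)` is surjective. -/
theorem exists_lift_of_not_isShortChainMiddle (K : Type u) {R M I₀ J I₁ : Type u} [CommRing K]
    [IsArtinianRing K] [Ring R] [Algebra K R] [Module.Finite K R] [AddCommGroup M] [Module R M]
    [Module.Finite R M] (hmid : ¬ IsShortChainMiddle R M)
    [AddCommGroup I₀] [Module R I₀] (hI₀ : Module.Baer R I₀) [AddCommGroup J] [Module R J]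
    [AddCommGroup I₁] [Module R I₁]
    (i₀ : M →ₗ[R] I₀) (q : I₀ →ₗ[R] J) (hq : Function.Surjective q)
    (hiq : LinearMap.range i₀ = LinearMap.ker q) (i₁ : J →ₗ[R] I₁) (hi₁ : Function.Injective i₁)
    (hess : ∀ U : Submodule R I₁, LinearMap.range i₁ ⊓ U = ⊥ → U = ⊥) (φ : M →ₗ[R] I₁) :
    ∃ ψ : M →ₗ[R] I₀, (i₁ ∘ₗ q) ∘ₗ ψ = φ := by
  have := IsArtinianRing.of_finite K R
  have := IsNoetherianRing.of_finite K R
  let M' := (LinearMap.range i₁).comap φ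
  let eq := LinearEquiv.ofInjective i₁ hi₁
  let θ : M' →ₗ[R] J := eq.symm ∘ₗ (φ ∘ₗ M'.subtype).codRestrict (LinearMap.range i₁) fun x ↦ x.2
  have hθ : ∀ x, i₁ (θ x) = φ x := fun x ↦ congrArg Subtype.val (eq.apply_symm_apply _)
  by_cases hlift : ∃ k : M' →ₗ[R] I₀, q ∘ₗ k = θ
  · obtain ⟨k, hk⟩ := hlift
    have hk' : ∀ x, q (k x) = θ x := LinearMap.congr_fun hk
    obtain ⟨ψ, hψ⟩ := hI₀.extension_property M'.subtype M'.subtype_injective k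
    have hψ' : ∀ x : M', ψ x = k x := LinearMap.congr_fun hψ
    refine ⟨ψ, ?_⟩
    have h0 : LinearMap.range (φ - (i₁ ∘ₗ q) ∘ₗ ψ) = ⊥ := hess _ <| by
      rw [eq_bot_iff]
      rintro _ ⟨⟨j, hj⟩, x, rfl⟩
      have hx : x ∈ M' := ⟨j + q (ψ x), by rw [map_add, hj]; simp⟩
      have h1 := hψ' ⟨x, hx⟩
      have h2 := hθ ⟨x, hx⟩
      simp only at h1 h2
      simp [h1, hk', h2]
    exact (sub_eq_zero.1 (LinearMap.range_eq_bot.1 h0)).symm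
  · obtain ⟨X, hX, hXi⟩ := exists_indecomposable_submodule
      (fun X : Submodule R M' ↦ ¬ ∃ k : X →ₗ[R] I₀, q ∘ₗ k = θ ∘ₗ X.subtype)
      (not_not.2 ⟨0, LinearMap.ext fun x ↦ by rw [Subsingleton.elim x 0, map_zero, map_zero]⟩)
      (fun ⟨k, hk⟩ ↦ hlift ⟨k ∘ₗ Submodule.topEquiv.symm.toLinearMap,
        LinearMap.ext fun x ↦ LinearMap.congr_fun hk ⟨x, trivial⟩⟩)
      (by
        intro X₁ X₂ hd h
        by_contra! hcon
        obtain ⟨⟨k₁, hk₁⟩, ⟨k₂, hk₂⟩⟩ := hcon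
        apply h
        let c : X₁ × X₂ →ₗ[R] ↥(X₁ ⊔ X₂) := (Submodule.inclusion le_sup_left).coprod
          (Submodule.inclusion le_sup_right)
        have hc : Function.Surjective c := fun ⟨x, hx⟩ ↦ by
          obtain ⟨y, hy, z, hz, rfl⟩ := Submodule.mem_sup.1 hx
          exact ⟨(⟨y, hy⟩, ⟨z, hz⟩), rfl⟩
        obtain ⟨k, hk⟩ := c.exists_comp_eq_of_surjective hc (k₁.coprod k₂) (by
          rintro ⟨⟨y, hy⟩, ⟨z, hz⟩⟩ hyz
          have h1 : y + z = 0 := congrArg Subtype.val hyz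
          have h2 : z = -y := (neg_eq_of_add_eq_zero_right h1).symm
          have h3 : y = 0 := Submodule.disjoint_def.1 hd y hy
            (by rw [← neg_neg y, ← h2]; exact X₂.neg_mem hz)
          subst h2 h3
          have h4 : (⟨0, hy⟩ : X₁) = 0 := rfl
          have h5 : (⟨-0, hz⟩ : X₂) = 0 := Subtype.ext neg_zero
          rw [h4, h5, Prod.mk_zero_zero]
          exact zero_mem _)
        refine ⟨k, (LinearMap.cancel_right hc).1 ?_⟩
        rw [LinearMap.comp_assoc, hk]
        ext x
        · simpa [c] using LinearMap.congr_fun hk₁ x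
        · simpa [c] using LinearMap.congr_fun hk₂ x)
    have := hXi.1
    refine absurd (.of_not_lift K hXi i₀ q hq hiq _ hX (M'.subtype ∘ₗ X.subtype) fun h0 ↦ ?_) hmid
    obtain ⟨x, hx⟩ := exists_ne (0 : X)
    exact hx (Subtype.ext (Subtype.ext (LinearMap.congr_fun h0 x)))

section HomLength

variable (K : Type*) [CommRing K] {R : Type*} [Ring R] [Algebra K R]

/-- The length over `K` of `Hom_R(V, W)`, for a `K`-algebra `R`. -/
noncomputable def homLength (R V W : Type*) [Ring R] [Algebra K R] [AddCommGroup V] [Module R V]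
    [AddCommGroup W] [Module R W] : ℕ∞ :=
  let := moduleOfAlgebra K R W
  have := moduleOfAlgebra_isScalarTower K R W
  Module.length K (V →ₗ[R] W)

variable {V V' V'' W : Type*} [AddCommGroup V] [Module R V] [AddCommGroup V'] [Module R V']
  [AddCommGroup V''] [Module R V''] [AddCommGroup W] [Module R W]

theorem homLength_add_of_exact_left (p : V →ₗ[R] V') (d : V'' →ₗ[R] V)
    (hp : Function.Surjective p) (hd : LinearMap.range d = LinearMap.ker p)
    (hs : ∀ φ : V'' →ₗ[R] W, ∃ ψ : V →ₗ[R] W, ψ ∘ₗ d = φ) :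
    homLength K R V W = homLength K R V' W + homLength K R V'' W := by
  let := moduleOfAlgebra K R W
  have := moduleOfAlgebra_isScalarTower K R W
  refine Module.length_eq_add_of_exact (LinearMap.lcomp K W p) (LinearMap.lcomp K W d)
    (fun x y h ↦ (LinearMap.cancel_right hp).1 h) hs fun φ ↦ ⟨fun h ↦ ?_, ?_⟩
  · exact p.exists_comp_eq_of_surjective hp φ <| by
      rw [← hd]
      rintro _ ⟨x, rfl⟩
      exact LinearMap.congr_fun h x
  · rintro ⟨ψ, rfl⟩
    ext x
    have : p (d x) = 0 := LinearMap.mem_ker.1 (hd ▸ ⟨x, rfl⟩)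
    change ψ (p (d x)) = 0
    rw [this, map_zero]
theorem homLength_add_of_exact_right (i : V →ₗ[R] V') (q : V' →ₗ[R] V'')
    (hi : Function.Injective i) (hq : LinearMap.range i = LinearMap.ker q)
    (hs : ∀ φ : W →ₗ[R] V'', ∃ ψ : W →ₗ[R] V', q ∘ₗ ψ = φ) :
    homLength K R W V' = homLength K R W V + homLength K R W V'' := by
  let := moduleOfAlgebra K R V
  have := moduleOfAlgebra_isScalarTower K R V
  let := moduleOfAlgebra K R V'
  have := moduleOfAlgebra_isScalarTower K R V'
  let := moduleOfAlgebra K R V''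
  have := moduleOfAlgebra_isScalarTower K R V''
  refine Module.length_eq_add_of_exact (LinearMap.compRight K i) (LinearMap.compRight K q)
    (fun x y h ↦ (LinearMap.cancel_left hi).1 h) hs fun φ ↦ ⟨fun h ↦ ?_, ?_⟩
  · have h1 : ∀ x, φ x ∈ LinearMap.range i := fun x ↦ hq ▸ LinearMap.congr_fun h x
    refine ⟨(LinearEquiv.ofInjective i hi).symm ∘ₗ φ.codRestrict _ h1, ?_⟩
    ext x
    exact congrArg Subtype.val
      ((LinearEquiv.ofInjective i hi).apply_symm_apply (φ.codRestrict _ h1 x))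
  · rintro ⟨ψ, rfl⟩
    ext x
    exact LinearMap.mem_ker.1 (hq ▸ ⟨ψ x, rfl⟩ : i (ψ x) ∈ LinearMap.ker q)

theorem homLength_le_left (d : V'' →ₗ[R] V) (h : ∀ φ : V →ₗ[R] W, φ ∘ₗ d = 0 → φ = 0) :
    homLength K R V W ≤ homLength K R V'' W := by
  let := moduleOfAlgebra K R W
  have := moduleOfAlgebra_isScalarTower K R W
  refine Module.length_le_of_injective (LinearMap.lcomp K W d) ?_
  rw [← LinearMap.ker_eq_bot, LinearMap.ker_eq_bot']
  exact h

theorem homLength_le_right (q : V' →ₗ[R] V'') (h : ∀ φ : W →ₗ[R] V', q ∘ₗ φ = 0 → φ = 0) :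
    homLength K R W V' ≤ homLength K R W V'' := by
  let := moduleOfAlgebra K R V'
  have := moduleOfAlgebra_isScalarTower K R V'
  let := moduleOfAlgebra K R V''
  have := moduleOfAlgebra_isScalarTower K R V''
  refine Module.length_le_of_injective (LinearMap.compRight K q) ?_
  rw [← LinearMap.ker_eq_bot, LinearMap.ker_eq_bot']
  exact h

theorem homLength_congr_left (e : V ≃ₗ[R] V') : homLength K R V W = homLength K R V' W :=
  le_antisymm
    (homLength_le_left K e.symm.toLinearMap fun _ h ↦ (LinearMap.cancel_right e.symm.surjective).1 h)
    (homLength_le_left K e.toLinearMap fun _ h ↦ (LinearMap.cancel_right e.surjective).1 h)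

theorem homLength_congr_right (e : V ≃ₗ[R] V') : homLength K R W V = homLength K R W V' :=
  le_antisymm
    (homLength_le_right K e.toLinearMap fun _ h ↦ LinearMap.ext fun x ↦
      e.injective ((LinearMap.congr_fun h x).trans (map_zero e).symm))
    (homLength_le_right K e.symm.toLinearMap fun _ h ↦ LinearMap.ext fun x ↦
      e.symm.injective ((LinearMap.congr_fun h x).trans (map_zero e.symm).symm))

theorem homLength_self_ne_zero [Nontrivial V] : homLength K R V V ≠ 0 := by
  let := moduleOfAlgebra K R V
  have := moduleOfAlgebra_isScalarTower K R V
  intro h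
  have : Subsingleton (V →ₗ[R] V) := Module.length_eq_zero_iff.1 h
  exact one_ne_zero (α := Module.End R V) (Subsingleton.elim _ _)

theorem homLength_ne_top [IsArtinianRing K] [Module.Finite K R] [Module.Finite R V]
    [Module.Finite R W] : homLength K R V W ≠ ⊤ := by
  let := moduleOfAlgebra K R W
  have := moduleOfAlgebra_isScalarTower K R W
  have : Module.Finite K W := .trans R W
  obtain ⟨n, π, hπ⟩ := Module.Finite.exists_fin' R V
  let c : (V →ₗ[R] W) →ₗ[K] (Fin n → W) :=
    { toFun := fun f i ↦ f (π (Pi.single i 1))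
      map_add' := fun _ _ ↦ rfl
      map_smul' := fun _ _ ↦ rfl }
  have : Module.Finite K (V →ₗ[R] W) := Module.Finite.of_injective c fun f g h ↦
    (LinearMap.cancel_right hπ).1 (LinearMap.pi_ext' fun i ↦ LinearMap.ext_ring (congrFun h i))
  exact Module.length_ne_top

end HomLength

/-- `f` takes the same value on modules with the same composition factors if it is additive on
short exact sequences. -/
theorem SameCompFactors.eq_of_additive {M N : Modc A} (h : SameCompFactors M N)
    (f : ∀ (V : Type u) [AddCommGroup V] [Module Aᵐᵒᵖ V], ℕ∞)
    (hiso : ∀ (V W : Type u) [AddCommGroup V] [Module Aᵐᵒᵖ V] [AddCommGroup W] [Module Aᵐᵒᵖ W],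
      (V ≃ₗ[Aᵐᵒᵖ] W) → f V = f W)
    (hadd : ∀ (V : Type u) [AddCommGroup V] [Module Aᵐᵒᵖ V] (S : Submodule Aᵐᵒᵖ V),
      f V = f S + f (V ⧸ S)) : f M = f N := by
  have key : ∀ (V : Type u) [AddCommGroup V] [Module Aᵐᵒᵖ V] (n : ℕ)
      (s : Fin (n + 1) → Submodule Aᵐᵒᵖ V), Monotone s → f (s (Fin.last n)) =
        f (s 0) + ∑ i : Fin n,
          f (s i.succ ⧸ Submodule.comap (s i.succ).subtype (s i.castSucc)) := fun V _ _ n ↦ by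
    induction n with
    | zero => intro s _; simp
    | succ n ih =>
      intro s hs
      have h1 := ih (s ∘ Fin.castSucc) (hs.comp (Fin.strictMono_castSucc).monotone)
      have h2 := hadd (s (Fin.last (n + 1)))
        (Submodule.comap (s (Fin.last (n + 1))).subtype (s (Fin.last n).castSucc))
      have h3 := hiso
        (Submodule.comap (s (Fin.last (n + 1))).subtype (s (Fin.last n).castSucc))
        (s (Fin.last n).castSucc)
        (Submodule.comapSubtypeEquivOfLe (hs (Fin.le_last (Fin.last n).castSucc)))
      rw [Fin.sum_univ_castSucc, ← add_assoc, h2, h3]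
      exact congrArg (· + _) h1
  obtain ⟨n, s, t, σ, hs, ht, hs0, hs1, ht0, ht1, hst⟩ := h
  have h1 := key M n s hs
  have h2 := key N n t ht
  rw [hs0, hs1, hiso _ _ Submodule.topEquiv] at h1
  rw [ht0, ht1, hiso _ _ Submodule.topEquiv, ← Equiv.sum_comp σ] at h2
  rw [h1, h2]
  congr 1
  · exact hiso _ _ 0
  · exact Finset.sum_congr rfl fun i _ ↦ hiso _ _ (hst i).some

theorem exists_hom_ne_zero_of_homLength_projective (K : Type u) {R M N : Type u} [CommRing K]
    [IsArtinianRing K] [Ring R] [Algebra K R] [Module.Finite K R] [AddCommGroup M] [Module R M]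
    [Module.Finite R M] [AddCommGroup N] [Module R N]
    (hM : IsIndecomposableModule R M) (hmid : ¬ IsShortChainMiddle R M)
    (hlen : ∀ (P : Type u) [AddCommGroup P] [Module R P] [Module.Projective R P],
      homLength K R P M = homLength K R P N) : ∃ g : M →ₗ[R] N, g ≠ 0 := by
  have := IsArtinianRing.of_finite K R
  have := IsNoetherianRing.of_finite K R
  obtain ⟨P₀, _, _, π, _, _, hπ, -⟩ := exists_projective_cover (R := R) (M := M)
  obtain ⟨P₁, _, _, ρ, _, _, hρ, hcov⟩ := exists_projective_cover (R := R) (M := LinearMap.ker π)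
  let d : P₁ →ₗ[R] P₀ := (LinearMap.ker π).subtype ∘ₗ ρ
  have hd : LinearMap.range d = LinearMap.ker π := by
    rw [LinearMap.range_comp_of_range_eq_top _ (LinearMap.range_eq_top.2 hρ),
      Submodule.range_subtype]
  have hkd : LinearMap.ker d = LinearMap.ker ρ :=
    LinearMap.ker_comp_of_ker_eq_bot _ (Submodule.ker_subtype _)
  have h1 := homLength_add_of_exact_left K π d hπ hd
    (exists_extend_of_not_isShortChainMiddle K hM hmid π hπ d hd (hkd ▸ hcov))
  by_contra! h0
  have h2 := homLength_le_left K (W := N) d fun φ hφ ↦ by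
    obtain ⟨l, rfl⟩ := π.exists_comp_eq_of_surjective hπ φ (by
      rw [← hd]
      rintro _ ⟨x, rfl⟩
      exact LinearMap.congr_fun hφ x)
    rw [h0 l, LinearMap.zero_comp]
  rw [← hlen, ← hlen, h1] at h2
  have := hM.1
  have h3 := homLength_self_ne_zero K (R := R) (V := M)
  obtain ⟨a, ha⟩ := ENat.ne_top_iff_exists.1 (homLength_ne_top K (R := R) (V := M) (W := M))
  obtain ⟨b, hb⟩ := ENat.ne_top_iff_exists.1 (homLength_ne_top K (R := R) (V := P₁) (W := M))
  rw [← ha] at h3 h2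
  rw [← hb] at h2
  norm_cast at h2 h3
  omega

theorem exists_hom_ne_zero_of_homLength_baer (K : Type u) {R M N : Type u} [CommRing K]
    [IsArtinianRing K] [Ring R] [Algebra K R] [Module.Finite K R] [AddCommGroup M] [Module R M]
    [Module.Finite R M] [AddCommGroup N] [Module R N]
    [Nontrivial M] (hmid : ¬ IsShortChainMiddle R M)
    (hlen : ∀ (I : Type u) [AddCommGroup I] [Module R I], Module.Baer R I →
      homLength K R M I = homLength K R N I) : ∃ f : N →ₗ[R] M, f ≠ 0 := by
  have := IsArtinianRing.of_finite K R
  have := IsNoetherianRing.of_finite K R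
  obtain ⟨I₀, _, _, i₀, _, hI₀, hi₀⟩ := exists_finite_baer_embedding K (R := R) M
  obtain ⟨I₁, _, _, i₁, _, hI₁, hi₁, hess⟩ :=
    exists_injective_hull K (R := R) (J := I₀ ⧸ LinearMap.range i₀)
  let q := (LinearMap.range i₀).mkQ
  have hq : LinearMap.range i₀ = LinearMap.ker q := (Submodule.ker_mkQ _).symm
  have hd : LinearMap.range i₀ = LinearMap.ker (i₁ ∘ₗ q) := by
    rw [LinearMap.ker_comp_of_ker_eq_bot _ (LinearMap.ker_eq_bot.2 hi₁)]
    exact hq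
  have h1 := homLength_add_of_exact_right K i₀ (i₁ ∘ₗ q) hi₀ hd
    (exists_lift_of_not_isShortChainMiddle K hmid hI₀ i₀ q (Submodule.mkQ_surjective _) hq i₁
      hi₁ hess)
  by_contra! h0
  have h2 := homLength_le_right K (W := N) (i₁ ∘ₗ q) fun φ hφ ↦ by
    have h3 : ∀ x, φ x ∈ LinearMap.range i₀ := fun x ↦ hd ▸ LinearMap.congr_fun hφ x
    have h4 := h0 ((LinearEquiv.ofInjective i₀ hi₀).symm ∘ₗ φ.codRestrict _ h3)
    ext x
    have h5 := LinearMap.congr_fun h4 x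
    rw [LinearMap.comp_apply, LinearEquiv.coe_coe, LinearMap.zero_apply,
      LinearEquiv.map_eq_zero_iff] at h5
    exact congrArg Subtype.val h5
  rw [← hlen _ hI₀, ← hlen _ hI₁, h1] at h2
  have h3 := homLength_self_ne_zero K (R := R) (V := M)
  obtain ⟨a, ha⟩ := ENat.ne_top_iff_exists.1 (homLength_ne_top K (R := R) (V := M) (W := M))
  obtain ⟨b, hb⟩ := ENat.ne_top_iff_exists.1 (homLength_ne_top K (R := R) (V := M) (W := I₁))
  rw [← ha] at h3 h2
  rw [← hb] at h2
  norm_cast at h2 h3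
  omega

theorem nonempty_linearEquiv_of_not_isShortChainMiddle (K : Type u) {R M N : Type u} [CommRing K]
    [IsArtinianRing K] [Ring R] [Algebra K R] [Module.Finite K R] [AddCommGroup M] [Module R M]
    [Module.Finite R M] [AddCommGroup N] [Module R N] [Module.Finite R N]
    (hM : IsIndecomposableModule R M) (hN : IsIndecomposableModule R N) (hmid : ¬ IsShortChainMiddle R M)
    {g : M →ₗ[R] N} (hg : g ≠ 0) {f : N →ₗ[R] M} (hf : f ≠ 0) : Nonempty (M ≃ₗ[R] N) := by
  have := IsArtinianRing.of_finite K R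
  have := IsNoetherianRing.of_finite K R
  by_cases h0 : f ∘ₗ g = 0
  · exact absurd (.of_comp_eq_zero K hN hg hf h0) hmid
  rcases hM.isUnit_or_isNilpotent (f ∘ₗ g) with hu | hn
  · obtain ⟨v, hv⟩ := hu.exists_left_inv
    have hv' : ∀ x, v (f (g x)) = x := LinearMap.congr_fun hv
    have hgi : Function.Injective g := Function.LeftInverse.injective (g := v ∘ₗ f) hv'
    rcases hN.2 (g ∘ₗ v ∘ₗ f) (LinearMap.ext fun x ↦ by simp [hv']) with h1 | h1
    · exact absurd (LinearMap.ext fun x ↦ by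
        have := LinearMap.congr_fun h1 (g x)
        simpa [hv'] using this) hg
    · exact ⟨.ofBijective g ⟨hgi, fun x ↦ ⟨_, LinearMap.congr_fun h1 x⟩⟩⟩
  · exfalso
    have := hM.1
    let h : Module.End R M := f ∘ₗ g
    have hh : IsNilpotent h := hn
    have h2 : 2 ≤ nilpotencyClass h := by
      by_contra! hlt
      have h3 : h ^ 1 = 0 := pow_eq_zero_of_le (by omega) (pow_nilpotencyClass hh)
      exact h0 (by rwa [pow_one] at h3)
    have h4 : h ^ (nilpotencyClass h - 1) ≠ 0 := pow_pred_nilpotencyClass hh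
    refine hmid (.of_comp_eq_zero K hM h4 h4 ?_)
    change h ^ (nilpotencyClass h - 1) * h ^ (nilpotencyClass h - 1) = 0
    rw [← pow_add]
    exact pow_eq_zero_of_le (by omega) (pow_nilpotencyClass hh)

theorem IsShortChainMiddle.isMiddleOfShortChain {M : Modc A} (h : IsShortChainMiddle Aᵐᵒᵖ M) :
    IsMiddleOfShortChain M := by
  obtain ⟨X, E, _, _, _, _, g, hX, hXi, hg, hs, hmin, hu, hv⟩ := h
  exact ⟨ModuleCat.of _ X, ModuleCat.of _ (LinearMap.ker g), ModuleCat.of _ E,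
    (LinearMap.ker g).subtype, g, hX, ⟨Submodule.subtype_injective _, hs,
    Submodule.range_subtype _, hg.isIndecomposableModule_ker hs hmin, hXi, hg.1,
    fun V h hh ↦ hg.2 V h hh, fun V h hh ↦ hg.exists_extension hs hmin h hh⟩, hu, hv⟩

/-- Indecomposable modules with the same composition factors
are isomorphic provided one of them is not the middle of a short chain. -/
theorem iso_of_sameCompFactors_of_not_middle
    (K : Type u) [CommRing K] [IsArtinianRing K]
    (A : Type u) [Ring A] [Algebra K A] [Module.Finite K A]
    (M N : Modc A) (hM : FinGen M) (hMi : Indec M)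
    (hN : FinGen N) (hNi : Indec N)
    (hcf : SameCompFactors M N) (hmid : ¬ IsMiddleOfShortChain M) :
    Nonempty (M ≃ₗ[Aᵐᵒᵖ] N) := by
  have : Module.Finite K Aᵐᵒᵖ := .equiv (MulOpposite.opLinearEquiv K)
  have : Module.Finite Aᵐᵒᵖ M := hM
  have : Module.Finite Aᵐᵒᵖ N := hN
  have hM' : IsIndecomposableModule Aᵐᵒᵖ M := hMi
  have := hM'.1
  have hmid' : ¬ IsShortChainMiddle Aᵐᵒᵖ M := fun h ↦ hmid h.isMiddleOfShortChain
  obtain ⟨g, hg⟩ := exists_hom_ne_zero_of_homLength_projective K (N := N) hM' hmid'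
    fun P _ _ _ ↦ hcf.eq_of_additive (fun V _ _ ↦ homLength K Aᵐᵒᵖ P V)
      (fun V W _ _ _ _ e ↦ homLength_congr_right K e)
      fun V _ _ S ↦ homLength_add_of_exact_right K S.subtype S.mkQ S.subtype_injective
        (by rw [Submodule.range_subtype, Submodule.ker_mkQ])
        fun φ ↦ Module.projective_lifting_property _ φ S.mkQ_surjective
  obtain ⟨f, hf⟩ := exists_hom_ne_zero_of_homLength_baer K (N := N) hmid'
    fun I _ _ hI ↦ hcf.eq_of_additive (fun V _ _ ↦ homLength K Aᵐᵒᵖ V I)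
      (fun V W _ _ _ _ e ↦ homLength_congr_left K e)
      fun V _ _ S ↦ (homLength_add_of_exact_left K S.mkQ S.subtype S.mkQ_surjective
        (by rw [Submodule.range_subtype, Submodule.ker_mkQ])
        fun φ ↦ hI.extension_property S.subtype S.subtype_injective φ).trans (add_comm _ _)
  exact nonempty_linearEquiv_of_not_isShortChainMiddle K hM' hNi hmid' hg hf
end

section
/- Let A be an artin algebra, M a module in mod A, and X an indecomposable module not isomorphic to a direct summand of M, with Hom_A(X, M) ≠ 0 and Hom_A(M, τ_A X) ≠ 0. Then there is a short path Y → V → Z of nonzero non-isomorphisms between indecomposables, where Y, Z are indecomposable direct summands of M, and V = X or V is an indecomposable direct summand of the middle term E of the Auslander-Reiten sequence 0 → τ_A X → E → X → 0. -/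
universe u

variable {A : Type u} [Ring A]

theorem exists_maximal_submodule_notMem {K Q : Type*} [Ring K] [AddCommGroup Q] [Module K Q]
    (B : Submodule K Q) {t : Q} (ht : t ∉ B) :
    ∃ Q' : Submodule K Q, B ≤ Q' ∧ t ∉ Q' ∧ ∀ N : Submodule K Q, Q' < N → t ∈ N := by
  obtain ⟨Q', hB, hmax⟩ := zorn_le_nonempty₀ {N : Submodule K Q | t ∉ N} (fun c hc hch y hy => by
    refine ⟨sSup c, ?_, fun z hz => le_sSup hz⟩
    intro hmem
    obtain ⟨z, hz, htz⟩ := (Submodule.mem_sSup_of_directed ⟨y, hy⟩ hch.directedOn).1 hmem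
    exact hc hz htz) B ht
  refine ⟨Q', hB, hmax.prop, fun N hN => ?_⟩
  by_contra hmem
  exact hN.not_ge (hmax.le_of_ge hmem hN.le)

/-- If a fixed nonzero element lies in every nonzero submodule of `J`, then the linear maps from
a module of finite length to `J` form a Noetherian module. -/
theorem IsFiniteLength.isNoetherian_linearMap {K J N : Type*} [CommRing K] [IsNoetherianRing K]
    [AddCommGroup J] [Module K J] [AddCommGroup N] [Module K N]
    {t : J} (ht0 : t ≠ 0) (ht : ∀ S : Submodule K J, S ≠ ⊥ → t ∈ S)
    (hN : IsFiniteLength K N) : IsNoetherian K (N →ₗ[K] J) := by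
  induction hN with
  | of_subsingleton => infer_instance
  | @of_simple_quotient N _ _ S hS _ ih =>
    have hquot : IsNoetherian K ((N ⧸ S) →ₗ[K] J) := by
      have := IsSimpleModule.nontrivial K (N ⧸ S)
      obtain ⟨s, hs⟩ := exists_ne (0 : N ⧸ S)
      have hmem : ∀ h : (N ⧸ S) →ₗ[K] J, h s ∈ Submodule.span K {t} := by
        intro h
        by_cases h0 : h = 0
        · simp [h0]
        have hinj : Function.Injective h := h.injective_or_eq_zero.resolve_right h0
        have hrange : LinearMap.range h ≠ ⊥ := by
          rwa [Ne, LinearMap.range_eq_bot]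
        obtain ⟨y, hy⟩ := ht _ hrange
        have hy0 : y ≠ 0 := by
          rintro rfl
          exact ht0 (by rw [← hy, map_zero])
        obtain ⟨c, hc⟩ := IsSimpleModule.toSpanSingleton_surjective K hy0 s
        rw [Submodule.mem_span_singleton]
        refine ⟨c, ?_⟩
        rw [← hy, ← hc]
        simp
      have hnoeth : IsNoetherian K (Submodule.span K {t}) :=
        isNoetherian_span_of_finite K (Set.finite_singleton t)
      refine isNoetherian_of_injective
        ((LinearMap.applyₗ (R := K) (M₂ := J) s).codRestrict (Submodule.span K {t}) hmem) ?_
      rw [injective_iff_map_eq_zero]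
      intro h hh
      have hh' : h s = 0 := congrArg Subtype.val hh
      refine h.injective_or_eq_zero.resolve_left fun hinj => hs (hinj ?_)
      rw [hh', map_zero]
    refine isNoetherian_of_range_eq_ker (LinearMap.lcomp K J S.mkQ) (LinearMap.lcomp K J S.subtype)
      (le_antisymm ?_ ?_)
    · rintro _ ⟨h, rfl⟩
      ext x
      have hx : S.mkQ x = 0 := by simp
      simp only [LinearMap.lcomp_apply, Submodule.subtype_apply, hx, map_zero,
        LinearMap.zero_apply]
    · intro h hh
      have hle : S ≤ LinearMap.ker h := fun x hx => LinearMap.congr_fun hh (⟨x, hx⟩ : S)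
      exact ⟨S.liftQ h hle, by ext x; simp⟩

/-- A linear system over a module-finite algebra `R` over a commutative Artinian ring which is
not solvable in `T` stays unsolvable modulo some submodule `T'` of `T`, which can only vanish if
`T` is finite. -/
theorem exists_submodule_linear_system_unsolvable {K R T ι κ : Type*} [CommRing K]
    [IsArtinianRing K] [Ring R] [Algebra K R] [Module.Finite K R] [AddCommGroup T] [Module R T]
    [Finite ι] [Fintype κ] (B : ι → κ → R) (t : ι → T)
    (ht : ¬ ∃ s : κ → T, ∀ i, t i = Fintype.linearCombination R s (B i)) :
    ∃ T' : Submodule R T, (T' = ⊥ → Module.Finite R T) ∧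
      ¬ ∃ s : κ → T, ∀ i, t i - Fintype.linearCombination R s (B i) ∈ T' := by
  classical
  have := Fintype.ofFinite ι
  let : Module K T := Module.compHom T (algebraMap K R)
  have : IsScalarTower K R T := ⟨fun a r x => by
    change (a • r) • x = algebraMap K R a • r • x
    rw [Algebra.smul_def, mul_smul]⟩
  have : SMulCommClass K R T := IsScalarTower.to_smulCommClass
  let F : (κ → T) →ₗ[K] (ι → T) :=
    LinearMap.pi fun i => ∑ j, (DistribSMul.toLinearMap K T (B i j)) ∘ₗ LinearMap.proj j
  have hF : ∀ s i, F s i = Fintype.linearCombination R s (B i) := by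
    intro s i
    simp [F, Fintype.linearCombination_apply]
  have htF : t ∉ LinearMap.range F := by
    rintro ⟨s, rfl⟩
    exact ht ⟨s, hF s⟩
  obtain ⟨Q, hFQ, htQ, hQ⟩ := exists_maximal_submodule_notMem _ htF
  let φ : ι → T →ₗ[K] ((ι → T) ⧸ Q) := fun i => Q.mkQ ∘ₗ LinearMap.single K (fun _ => T) i
  have hφ : ∀ x : ι → T, Q.mkQ x = ∑ i, φ i (x i) := by
    intro x
    simp only [φ, LinearMap.comp_apply, ← map_sum]
    congr 1
    exact (Finset.univ_sum_single x).symm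
  let T' : Submodule R T :=
    { carrier := {x | ∀ i (r : R), φ i (r • x) = 0}
      zero_mem' := by simp
      add_mem' := by
        intro x y hx hy i r
        rw [smul_add, map_add, hx, hy, add_zero]
      smul_mem' := by
        intro c x hx i r
        rw [← mul_smul]
        exact hx i _ }
  refine ⟨T', fun hT' => ?_, ?_⟩
  · have hlen : IsFiniteLength K R := by
      rw [isFiniteLength_iff_isNoetherian_isArtinian]
      exact ⟨inferInstance, inferInstance⟩
    have hmk : Q.mkQ t ≠ 0 := by
      simpa using htQ
    have hmem : ∀ S : Submodule K ((ι → T) ⧸ Q), S ≠ ⊥ → Q.mkQ t ∈ S := by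
      intro S hS
      refine hQ (S.comap Q.mkQ) (lt_of_le_of_ne (Submodule.le_comap_mkQ Q S) fun h => hS ?_)
      rw [← Submodule.map_comap_eq_of_surjective Q.mkQ_surjective S, ← h, Submodule.mkQ_map_self]
    have := hlen.isNoetherian_linearMap hmk hmem
    let Ψ : T →ₗ[K] (ι → R →ₗ[K] ((ι → T) ⧸ Q)) :=
      LinearMap.pi fun i => LinearMap.mk₂ K (fun x r => φ i (r • x))
        (fun x y r => by rw [smul_add, map_add]) (fun c x r => by rw [smul_comm, map_smul])
        (fun x r r' => by rw [add_smul, map_add]) (fun c x r => by rw [smul_assoc, map_smul])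
    have hΨ : Function.Injective Ψ := by
      rw [injective_iff_map_eq_zero]
      intro x hx
      have hxT' : x ∈ T' := fun i r => LinearMap.congr_fun (congrFun hx i) r
      rwa [hT', Submodule.mem_bot] at hxT'
    have := isNoetherian_of_injective Ψ hΨ
    exact Module.Finite.of_restrictScalars_finite K R T
  · rintro ⟨s, hs⟩
    refine htQ ?_
    have hzero : Q.mkQ (t - F s) = 0 := by
      rw [hφ]
      refine Finset.sum_eq_zero fun i _ => ?_
      have := hs i i 1
      rwa [one_smul, ← hF] at this
    have hsub : t - F s ∈ Q := (Submodule.Quotient.mk_eq_zero Q).1 hzero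
    simpa using Q.add_mem hsub (hFQ ⟨s, rfl⟩)

/-- If `0 → T → E → X → 0` is a nonsplit exact sequence with `X` finite, such that the projection
of `T` onto each proper quotient extends to `E`, then `T` is finite. -/
theorem finite_of_forall_mkQ_extends {K R T E X : Type*} [CommRing K] [IsArtinianRing K] [Ring R]
    [Algebra K R] [Module.Finite K R] [AddCommGroup T] [Module R T] [AddCommGroup E] [Module R E]
    [AddCommGroup X] [Module R X] [Module.Finite R X] (f : T →ₗ[R] E) (g : E →ₗ[R] X)
    (hg : Function.Surjective g) (hfg : LinearMap.range f = LinearMap.ker g)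
    (hsplit : ¬ ∃ s : X →ₗ[R] E, g ∘ₗ s = LinearMap.id)
    (hext : ∀ T' : Submodule R T, T' ≠ ⊥ → ∃ k : E →ₗ[R] T ⧸ T', k ∘ₗ f = T'.mkQ) :
    Module.Finite R T := by
  have : IsArtinianRing R := IsArtinianRing.of_finite K R
  obtain ⟨n, π, hπ⟩ := Module.Finite.exists_fin' R X
  obtain ⟨a, ha⟩ := Module.projective_lifting_property g π hg
  obtain ⟨m, B, hB⟩ := Submodule.fg_iff_exists_fin_generating_family.1
    (IsNoetherian.noetherian (LinearMap.ker π))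
  have hBπ : ∀ i, π (B i) = 0 := fun i =>
    LinearMap.mem_ker.1 (hB ▸ Submodule.subset_span ⟨i, rfl⟩)
  have hlift : ∀ i, ∃ t, f t = a (B i) := fun i => by
    rw [← LinearMap.mem_range, hfg, LinearMap.mem_ker, ← LinearMap.comp_apply, ha, hBπ]
  choose t ht using hlift
  have hunsolvable : ¬ ∃ s : Fin n → T, ∀ i, t i = Fintype.linearCombination R s (B i) := by
    rintro ⟨s, hs⟩
    refine hsplit ?_
    have hker : LinearMap.ker π ≤ LinearMap.ker (a - f ∘ₗ Fintype.linearCombination R s) := by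
      rw [← hB, Submodule.span_le]
      rintro _ ⟨i, rfl⟩
      simp [← hs, ht]
    refine ⟨(LinearMap.ker π).liftQ _ hker ∘ₗ (π.quotKerEquivOfSurjective hπ).symm, ?_⟩
    ext x
    obtain ⟨y, rfl⟩ := hπ x
    have hy : (π.quotKerEquivOfSurjective hπ).symm (π y) = (LinearMap.ker π).mkQ y := by
      rw [LinearEquiv.symm_apply_eq]
      rfl
    have hgf : g (f (Fintype.linearCombination R s y)) = 0 :=
      LinearMap.mem_ker.1 (hfg ▸ ⟨_, rfl⟩)
    simpa [hy, hgf] using LinearMap.congr_fun ha y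
  obtain ⟨T', hT', hT's⟩ := exists_submodule_linear_system_unsolvable (K := K) B t hunsolvable
  refine hT' ?_
  by_contra hne
  obtain ⟨k, hk⟩ := hext T' hne
  choose s hs using fun j : Fin n => T'.mkQ_surjective (k (a (Pi.single j 1)))
  have hka : k ∘ₗ a = T'.mkQ ∘ₗ Fintype.linearCombination R s := by
    ext j
    simp [← hs]
  refine hT's ⟨s, fun i => ?_⟩
  have h1 := LinearMap.congr_fun hka (B i)
  have h2 := LinearMap.congr_fun hk (t i)
  rw [LinearMap.comp_apply, ht] at h2
  rw [LinearMap.comp_apply, h2, LinearMap.comp_apply, ← sub_eq_zero, ← map_sub] at h1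
  exact (Submodule.Quotient.mk_eq_zero T').1 h1

/-- A nonzero idempotent which is not the sum of two nonzero orthogonal idempotents. -/
structure IsPrimitiveIdempotent {S : Type*} [Ring S] (e : S) : Prop where
  ne_zero : e ≠ 0
  idem : e * e = e
  eq_zero_or_eq : ∀ a : S, a * a = a → e * a = a → a * e = a → a = 0 ∨ a = e

theorem LinearMap.range_lt_range_of_mul_eq {R W : Type*} [Ring R] [AddCommGroup W] [Module R W]
    {e a : Module.End R W} (ha : a * a = a) (hea : e * a = a) (hae : a * e = a) (hne : a ≠ e) :
    LinearMap.range a < LinearMap.range e := by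
  refine lt_of_le_of_ne ?_ fun h => hne ?_
  · rw [← hea]
    exact LinearMap.range_comp_le_range a e
  · rw [← hae]
    ext x
    obtain ⟨y, hy⟩ : e x ∈ LinearMap.range a := h ▸ ⟨x, rfl⟩
    change a (e x) = e x
    rw [← hy]
    exact LinearMap.congr_fun ha y

/-- Induction on idempotent endomorphisms of an Artinian module, via decompositions into primitive
idempotents. -/
theorem idempotent_induction {R W : Type*} [Ring R] [AddCommGroup W] [Module R W] [IsArtinian R W]
    {P : Module.End R W → Prop} (h_zero : P 0) (h_prim : ∀ e, IsPrimitiveIdempotent e → P e)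
    (h_add : ∀ e₁ e₂, P e₁ → P e₂ → P (e₁ + e₂))
    (e : Module.End R W) (he : e * e = e) : P e := by
  induction hN : LinearMap.range e using WellFoundedLT.induction generalizing e with
  | ind N ih =>
    subst hN
    by_cases h0 : e = 0
    · exact h0 ▸ h_zero
    by_cases hprim : IsPrimitiveIdempotent e
    · exact h_prim e hprim
    obtain ⟨a, ha, hea, hae, ha0, hane⟩ : ∃ a : Module.End R W,
        a * a = a ∧ e * a = a ∧ a * e = a ∧ a ≠ 0 ∧ a ≠ e := by
      by_contra! hcon
      refine hprim ⟨h0, he, fun a ha hea hae => ?_⟩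
      by_cases ha0 : a = 0
      · exact .inl ha0
      · exact .inr (hcon a ha hea hae ha0)
    have hb : (e - a) * (e - a) = e - a := by
      rw [sub_mul, mul_sub, mul_sub, he, hea, hae, ha]
      abel
    have hlt := LinearMap.range_lt_range_of_mul_eq hb (by rw [mul_sub, he, hea])
      (by rw [sub_mul, he, hae]) (by simpa using ha0)
    rw [← add_sub_cancel a e]
    exact h_add a (e - a)
      (ih _ (LinearMap.range_lt_range_of_mul_eq ha hea hae hane) a ha rfl) (ih _ hlt _ hb rfl)

/-- A nonzero linear map out of an Artinian module is nonzero on a primitive summand. -/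
theorem exists_primitive_comp_ne_zero {R W L : Type*} [Ring R] [AddCommGroup W] [Module R W]
    [IsArtinian R W] [AddCommGroup L] [Module R L] {v : W →ₗ[R] L} (hv : v ≠ 0) :
    ∃ e : Module.End R W, IsPrimitiveIdempotent e ∧ v ∘ₗ e ≠ 0 := by
  by_contra! hcon
  refine hv (idempotent_induction (P := fun e => v ∘ₗ e = 0) (LinearMap.comp_zero v) hcon
    (fun e₁ e₂ h₁ h₂ => ?_) 1 (one_mul 1))
  rw [LinearMap.comp_add, h₁, h₂, add_zero]

/-- A nonzero linear map into an Artinian module has a nonzero component in a primitive summand. -/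
theorem exists_primitive_comp_ne_zero' {R W L : Type*} [Ring R] [AddCommGroup W] [Module R W]
    [IsArtinian R W] [AddCommGroup L] [Module R L] {u : L →ₗ[R] W} (hu : u ≠ 0) :
    ∃ e : Module.End R W, IsPrimitiveIdempotent e ∧ e ∘ₗ u ≠ 0 := by
  by_contra! hcon
  refine hu (idempotent_induction (P := fun e => e ∘ₗ u = 0) (LinearMap.zero_comp u) hcon
    (fun e₁ e₂ h₁ h₂ => ?_) 1 (one_mul 1))
  rw [LinearMap.add_comp, h₁, h₂, add_zero]

/-- If each primitive idempotent `e` of `W` satisfies `e ∘ v = 0` or `u ∘ e = 0`, then some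
endomorphism of `W` which is killed by `u` fixes `v`. -/
theorem exists_comp_eq_of_forall_primitive {R W L N : Type*} [Ring R] [AddCommGroup W]
    [Module R W] [IsArtinian R W] [AddCommGroup L] [Module R L] [AddCommGroup N] [Module R N]
    (v : L →ₗ[R] W) (u : W →ₗ[R] N)
    (h : ∀ e : Module.End R W, IsPrimitiveIdempotent e → e ∘ₗ v = 0 ∨ u ∘ₗ e = 0) :
    ∃ a : Module.End R W, u ∘ₗ a = 0 ∧ a ∘ₗ v = v := by
  obtain ⟨a, b, hab, hua, hbv⟩ := idempotent_induction
    (P := fun e => ∃ a b : Module.End R W, e = a + b ∧ u ∘ₗ a = 0 ∧ b ∘ₗ v = 0)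
    ⟨0, 0, by simp⟩
    (fun e he => (h e he).elim (fun h => ⟨0, e, by simp [h]⟩) (fun h => ⟨e, 0, by simp [h]⟩))
    (fun e₁ e₂ ⟨a₁, b₁, he₁, hua₁, hbv₁⟩ ⟨a₂, b₂, he₂, hua₂, hbv₂⟩ =>
      ⟨a₁ + a₂, b₁ + b₂, by rw [he₁, he₂]; abel, by rw [LinearMap.comp_add, hua₁, hua₂, add_zero],
        by rw [LinearMap.add_comp, hbv₁, hbv₂, add_zero]⟩)
    1 (one_mul 1)
  refine ⟨a, hua, ?_⟩
  calc a ∘ₗ v = (a + b) ∘ₗ v := by rw [LinearMap.add_comp, hbv, add_zero]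
    _ = v := by rw [← hab]; rfl

theorem IsPrimitiveIdempotent.indec_range {M : Modc A} {e : Module.End Aᵐᵒᵖ M}
    (he : IsPrimitiveIdempotent e) : Indec (ModuleCat.of Aᵐᵒᵖ (LinearMap.range e)) := by
  refine ⟨?_, fun (h : Module.End Aᵐᵒᵖ (LinearMap.range e)) hh => ?_⟩
  · change Nontrivial (LinearMap.range e)
    rw [Submodule.nontrivial_iff_ne_bot, Ne, LinearMap.range_eq_bot]
    exact he.ne_zero
  · have hfix : ∀ y : LinearMap.range e, e.rangeRestrict y = y := by
      rintro ⟨_, x, rfl⟩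
      exact Subtype.ext (LinearMap.congr_fun he.idem x)
    have hfix' : ∀ y : LinearMap.range e, e y = y := fun y => congrArg Subtype.val (hfix y)
    let a : Module.End Aᵐᵒᵖ M := (LinearMap.range e).subtype ∘ₗ h ∘ₗ e.rangeRestrict
    have hval : ∀ y : LinearMap.range e, a y = h y := fun y => by
      change ((h (e.rangeRestrict y) : LinearMap.range e) : M) = h y
      rw [hfix]
    have haa : a * a = a := by
      ext x
      change a ((h (e.rangeRestrict x) : LinearMap.range e) : M) = _
      rw [hval]
      exact congrArg Subtype.val (LinearMap.congr_fun hh (e.rangeRestrict x))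
    have hea : e * a = a := by
      ext x
      exact hfix' (h (e.rangeRestrict x))
    have hae : a * e = a := by
      ext x
      change ((h (e.rangeRestrict (e x)) : LinearMap.range e) : M) = _
      rw [show e.rangeRestrict (e x) = e.rangeRestrict x from hfix (e.rangeRestrict x)]
      rfl
    rcases he.eq_zero_or_eq a haa hea hae with h0 | h1
    · left
      ext y
      rw [← hval, h0]
      rfl
    · right
      ext y
      rw [← hval, h1]
      exact hfix' y

theorem isDirectSummandOf_range {M : Modc A} {e : Module.End Aᵐᵒᵖ M} (he : e * e = e) :
    IsDirectSummandOf (ModuleCat.of Aᵐᵒᵖ (LinearMap.range e)) M := by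
  refine ⟨(LinearMap.range e).subtype, e.rangeRestrict, ?_⟩
  ext y
  obtain ⟨_, x, rfl⟩ := y
  exact LinearMap.congr_fun he x

theorem IsDirectSummandOf.of_equiv {X Y M : Modc A} (φ : X ≃ₗ[Aᵐᵒᵖ] Y)
    (hY : IsDirectSummandOf Y M) : IsDirectSummandOf X M := by
  obtain ⟨i, r, hri⟩ := hY
  refine ⟨i ∘ₗ φ, φ.symm ∘ₗ r, ?_⟩
  ext x
  have := LinearMap.congr_fun hri (φ x)
  simp only [LinearMap.comp_apply, LinearMap.id_apply] at this
  simp [this]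

theorem IsDirectSummandOf.exists_comp_ne_zero {V M X : Modc A} (hV : IsDirectSummandOf V M)
    {q : V →ₗ[Aᵐᵒᵖ] X} (hq : q ≠ 0) : ∃ w : M →ₗ[Aᵐᵒᵖ] X, w ≠ 0 := by
  obtain ⟨i, r, hri⟩ := hV
  refine ⟨q ∘ₗ r, fun h => hq ?_⟩
  rw [← LinearMap.comp_id q, ← hri, ← LinearMap.comp_assoc, h, LinearMap.zero_comp]

namespace IsAlmostSplitSeq

variable {T E X : Modc A} {f : T →ₗ[Aᵐᵒᵖ] E} {g : E →ₗ[Aᵐᵒᵖ] X}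

theorem not_isSplitMono (h : IsAlmostSplitSeq T E X f g) : ¬ IsSplitMono f := by
  obtain ⟨-, hsurj, hfg, -, -, hsplit, -, -⟩ := h
  rintro ⟨r, hr⟩
  have hker : LinearMap.ker g ≤ LinearMap.ker (LinearMap.id - f ∘ₗ r) := by
    rw [← hfg]
    rintro _ ⟨t, rfl⟩
    have := LinearMap.congr_fun hr t
    simp only [LinearMap.comp_apply, LinearMap.id_apply] at this
    simp [this]
  refine hsplit ⟨(LinearMap.ker g).liftQ _ hker ∘ₗ (g.quotKerEquivOfSurjective hsurj).symm, ?_⟩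
  ext x
  obtain ⟨y, rfl⟩ := hsurj x
  have hy : (g.quotKerEquivOfSurjective hsurj).symm (g y) = (LinearMap.ker g).mkQ y := by
    rw [LinearEquiv.symm_apply_eq]
    rfl
  have hgf : g (f (r y)) = 0 := LinearMap.mem_ker.1 (hfg ▸ ⟨_, rfl⟩)
  simp [hy, hgf]

theorem finite_left {K : Type*} [CommRing K] [IsArtinianRing K] [Algebra K A] [Module.Finite K A]
    (h : IsAlmostSplitSeq T E X f g) (hX : FinGen X) : FinGen T := by
  have : Module.Finite Aᵐᵒᵖ X := hX
  have : Module.Finite K Aᵐᵒᵖ := Module.Finite.equiv (MulOpposite.opLinearEquiv K)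
  obtain ⟨-, hsurj, hfg, -, -, hsplit, -, hext⟩ := h
  refine finite_of_forall_mkQ_extends (K := K) f g hsurj hfg hsplit fun T' hT' => ?_
  refine hext (ModuleCat.of Aᵐᵒᵖ (T ⧸ T')) T'.mkQ ?_
  rintro ⟨r, hr⟩
  refine hT' ((Submodule.eq_bot_iff T').2 fun x hx => ?_)
  have hx' : T'.mkQ x = 0 := (Submodule.Quotient.mk_eq_zero T').2 hx
  have := LinearMap.congr_fun hr x
  rw [LinearMap.comp_apply] at this
  erw [hx', map_zero] at this
  exact this.symm

/-- If an endomorphism `a` of the middle term fixes a nonzero element of the image of `f`, then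
`g ∘ a` is onto. -/
theorem surjective_comp_of_comp_eq (h : IsAlmostSplitSeq T E X f g) {a : Module.End Aᵐᵒᵖ E}
    {t : T} (ht : t ≠ 0) (hat : a (f t) = f t) :
    Function.Surjective (g ∘ₗ a) := by
  have hsplit := h.not_isSplitMono
  obtain ⟨hinj, -, hfg, -, -, -, hright, hleft⟩ := h
  rw [← LinearMap.range_eq_top]
  by_contra hne
  let W := LinearMap.range (g ∘ₗ a)
  obtain ⟨k, hk⟩ := hright (ModuleCat.of Aᵐᵒᵖ W) W.subtype (by
    rintro ⟨s, hs⟩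
    refine hne (eq_top_iff.2 fun x _ => ?_)
    have hx : W.subtype (s x) = x := LinearMap.congr_fun hs x
    exact hx ▸ (s x).2)
  let k' : W →ₗ[Aᵐᵒᵖ] E := k
  have hk' : ∀ w : W, g (k' w) = w := LinearMap.congr_fun hk
  let d : E →ₗ[Aᵐᵒᵖ] E := a - k' ∘ₗ (g ∘ₗ a).rangeRestrict
  have hgd : ∀ x, d x ∈ LinearMap.range f := by
    intro x
    rw [hfg, LinearMap.mem_ker]
    change g (a x - k' ((g ∘ₗ a).rangeRestrict x)) = 0
    rw [map_sub, hk', sub_eq_zero]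
    rfl
  let c : E →ₗ[Aᵐᵒᵖ] T := (LinearEquiv.ofInjective f hinj).symm ∘ₗ d.codRestrict _ hgd
  have hc : ∀ x, f (c x) = d x := fun x =>
    congrArg Subtype.val ((LinearEquiv.ofInjective f hinj).apply_symm_apply (d.codRestrict _ hgd x))
  have hsm : IsSplitMono (LinearMap.id - c ∘ₗ f) := by
    by_contra hns
    obtain ⟨c', hc'⟩ := hleft T _ hns
    refine hsplit ⟨c' + c, ?_⟩
    rw [LinearMap.add_comp, hc', sub_add_cancel]
  obtain ⟨r, hr⟩ := hsm
  have hgft : g (f t) = 0 := LinearMap.mem_ker.1 (hfg ▸ ⟨_, rfl⟩)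
  have hzero : (g ∘ₗ a).rangeRestrict (f t) = 0 := Subtype.ext (by
    change g (a (f t)) = 0
    rw [hat, hgft])
  have hct : c (f t) = t := hinj (by
    rw [hc]
    change a (f t) - k' ((g ∘ₗ a).rangeRestrict (f t)) = f t
    rw [hzero, map_zero, sub_zero, hat])
  have hrt : r (t - c (f t)) = t := LinearMap.congr_fun hr t
  rw [hct, sub_self, map_zero] at hrt
  exact ht hrt.symm

end IsAlmostSplitSeq

/-- (Lemma of Reiten-Skowroński.) If `X` is indecomposable,
not a direct summand of `M`, with `Hom(X, M) ≠ 0` and `Hom(M, τ_A X) ≠ 0`, then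
there is a short path `Y → V → Z` with `Y, Z` indecomposable direct summands of
`M` and `V = X` or `V` an indecomposable direct summand of the middle term `E`
of the almost split sequence `0 → τ_A X → E → X → 0`. -/
theorem short_path_lemma
    (K : Type u) [CommRing K] [IsArtinianRing K]
    (A : Type u) [Ring A] [Algebra K A] [Module.Finite K A]
    (M X T E : Modc A) (hMfg : FinGen M) (hX : FinGen X) (hXi : Indec X)
    (hXM : ¬ IsDirectSummandOf X M)
    (f : T →ₗ[Aᵐᵒᵖ] E) (g : E →ₗ[Aᵐᵒᵖ] X)
    (hars : IsAlmostSplitSeq T E X f g)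
    (hXtoM : ∃ u : X →ₗ[Aᵐᵒᵖ] M, u ≠ 0)
    (hMtoT : ∃ v : M →ₗ[Aᵐᵒᵖ] T, v ≠ 0) :
    ∃ (Y V Z : Modc A) (p : Y →ₗ[Aᵐᵒᵖ] V) (q : V →ₗ[Aᵐᵒᵖ] Z),
      IsDirectSummandOf Y M ∧ Indec Y ∧
      IsDirectSummandOf Z M ∧ Indec Z ∧ Indec V ∧
      (Nonempty (V ≃ₗ[Aᵐᵒᵖ] X) ∨ IsDirectSummandOf V E) ∧
      p ≠ 0 ∧ ¬ Function.Bijective p ∧ q ≠ 0 ∧ ¬ Function.Bijective q := by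
  have : Module.Finite K Aᵐᵒᵖ := Module.Finite.equiv (MulOpposite.opLinearEquiv K)
  have : IsArtinianRing Aᵐᵒᵖ := IsArtinianRing.of_finite K Aᵐᵒᵖ
  have : Module.Finite Aᵐᵒᵖ M := hMfg
  have : Module.Finite Aᵐᵒᵖ X := hX
  have : Module.Finite Aᵐᵒᵖ T := hars.finite_left (K := K) hX
  have : IsArtinian Aᵐᵒᵖ E := isArtinian_of_range_eq_ker f g hars.2.2.1
  obtain ⟨u, hu⟩ := hXtoM
  obtain ⟨v, hv⟩ := hMtoT
  by_cases hMX : ∃ w : M →ₗ[Aᵐᵒᵖ] X, w ≠ 0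
  · obtain ⟨w, hw⟩ := hMX
    obtain ⟨y, hy, hwy⟩ := exists_primitive_comp_ne_zero hw
    obtain ⟨z, hz, hzu⟩ := exists_primitive_comp_ne_zero' hu
    have hYM := isDirectSummandOf_range hy.idem
    have hZM := isDirectSummandOf_range hz.idem
    refine ⟨_, X, _, w ∘ₗ (LinearMap.range y).subtype, z.rangeRestrict ∘ₗ u, hYM, hy.indec_range,
      hZM, hz.indec_range, hXi, .inl ⟨.refl _ _⟩, fun h => hwy ?_,
      fun h => hXM (hYM.of_equiv (LinearEquiv.ofBijective _ h).symm), fun h => hzu ?_,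
      fun h => hXM (hZM.of_equiv (LinearEquiv.ofBijective _ h))⟩
    · ext x
      exact LinearMap.congr_fun h (y.rangeRestrict x)
    · ext x
      exact congrArg Subtype.val (LinearMap.congr_fun h x)
  · obtain ⟨e, he, hev, hue⟩ : ∃ e : Module.End Aᵐᵒᵖ E, IsPrimitiveIdempotent e ∧
        e ∘ₗ (f ∘ₗ v) ≠ 0 ∧ (u ∘ₗ g) ∘ₗ e ≠ 0 := by
      by_contra! hcon
      obtain ⟨a, hua, hav⟩ := exists_comp_eq_of_forall_primitive (f ∘ₗ v) (u ∘ₗ g)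
        fun e he => or_iff_not_imp_left.2 (hcon e he)
      obtain ⟨m, hm⟩ : ∃ m, v m ≠ 0 := by
        by_contra! h
        exact hv (LinearMap.ext h)
      have hsurj := hars.surjective_comp_of_comp_eq hm (LinearMap.congr_fun hav m)
      refine hu (LinearMap.ext fun x => ?_)
      obtain ⟨x', rfl⟩ := hsurj x
      exact LinearMap.congr_fun hua x'
    obtain ⟨y, hy, hevy⟩ := exists_primitive_comp_ne_zero hev
    obtain ⟨z, hz, hzue⟩ := exists_primitive_comp_ne_zero' hue
    have hYM := isDirectSummandOf_range hy.idem
    have hZM := isDirectSummandOf_range hz.idem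
    have hVM : ¬ IsDirectSummandOf (ModuleCat.of Aᵐᵒᵖ (LinearMap.range e)) M := by
      intro hVM
      refine hMX (hVM.exists_comp_ne_zero (q := g ∘ₗ (LinearMap.range e).subtype) fun h => hue ?_)
      ext x
      have : g (e x) = 0 := LinearMap.congr_fun h (e.rangeRestrict x)
      change u (g (e x)) = 0
      rw [this, map_zero]
    refine ⟨_, _, _, (e.rangeRestrict ∘ₗ f ∘ₗ v) ∘ₗ (LinearMap.range y).subtype,
      z.rangeRestrict ∘ₗ u ∘ₗ g ∘ₗ (LinearMap.range e).subtype, hYM, hy.indec_range, hZM,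
      hz.indec_range, he.indec_range, .inr (isDirectSummandOf_range he.idem), fun h => hevy ?_,
      fun h => hVM (hYM.of_equiv (LinearEquiv.ofBijective _ h).symm), fun h => hzue ?_,
      fun h => hVM (hZM.of_equiv (LinearEquiv.ofBijective _ h))⟩
    · ext x
      exact congrArg Subtype.val (LinearMap.congr_fun h (y.rangeRestrict x))
    · ext x
      exact congrArg Subtype.val (LinearMap.congr_fun h (e.rangeRestrict x))
end

section
/- Let A be an artin algebra, M a module in mod A, X an indecomposable module with Hom_A(X, M) ≠ 0 and Hom_A(M, τ_A X) ≠ 0 (so M is the middle of a short chain X → M → τ_A X). If C is a component of Γ_A without external short paths and M ∈ add(C), then X belongs to C. -/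
universe u

variable {A : Type u} [Ring A]

section Generic

variable {R : Type*} [Ring R]

/-- A linear surjection splits as soon as some lift of a cover of its target can be corrected,
by a map into the kernel, to vanish on the kernel of the cover. -/
theorem exists_section_of_eqOn_ker {P E X : Type*} [AddCommGroup P] [Module R P]
    [AddCommGroup E] [Module R E] [AddCommGroup X] [Module R X]
    (q : P →ₗ[R] X) (hq : Function.Surjective q) (g : E →ₗ[R] X) (p : P →ₗ[R] E)
    (hp : g ∘ₗ p = q) (d : P →ₗ[R] E) (hd : g ∘ₗ d = 0) (h : ∀ z ∈ LinearMap.ker q, d z = p z) :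
    ∃ s : X →ₗ[R] E, g ∘ₗ s = LinearMap.id := by
  have hker : LinearMap.ker q ≤ LinearMap.ker (p - d) := by
    intro z hz
    simp [h z hz]
  let e := q.quotKerEquivOfSurjective hq
  refine ⟨(LinearMap.ker q).liftQ (p - d) hker ∘ₗ e.symm.toLinearMap, ?_⟩
  ext x
  obtain ⟨z, rfl⟩ := hq x
  have he : e.symm (q z) = Submodule.Quotient.mk z := by
    rw [LinearEquiv.symm_apply_eq]
    rfl
  have h1 : g (p z) = q z := LinearMap.congr_fun hp z
  have h2 : g (d z) = 0 := LinearMap.congr_fun hd z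
  simp [he, h1, h2]

/-- The submodule of eventually vanishing families indexed by a directed preorder. -/
def eventuallyZero (R : Type*) [Ring R] (I T : Type*) [Preorder I] [Nonempty I]
    [IsDirectedOrder I] [AddCommGroup T] [Module R T] : Submodule R (I → T) where
  carrier := {y | ∀ᶠ i in Filter.atTop, y i = 0}
  zero_mem' := Filter.Eventually.of_forall fun _ => rfl
  add_mem' {a b} ha hb := by
    filter_upwards [ha, hb] with i h1 h2
    simp [h1, h2]
  smul_mem' r a ha := by
    filter_upwards [ha] with i h1
    simp [h1]

/-- The diagonal embedding of a module in its reduced power over a directed preorder. -/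
def reducedDiagonal (R : Type*) [Ring R] (I T : Type*) [Preorder I] [Nonempty I]
    [IsDirectedOrder I] [AddCommGroup T] [Module R T] :
    T →ₗ[R] (I → T) ⧸ eventuallyZero R I T :=
  (eventuallyZero R I T).mkQ ∘ₗ LinearMap.pi fun _ => LinearMap.id

/-- The diagonal embedding into a reduced power is pure: over a Noetherian ring, an extension by
a finitely generated module splits once the diagonal of its kernel extends to the middle term. -/
theorem exists_section_of_reducedDiagonal_extends [IsNoetherianRing R] {I T E X : Type*}
    [Preorder I] [Nonempty I] [IsDirectedOrder I] [AddCommGroup T] [Module R T]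
    [AddCommGroup E] [Module R E] [AddCommGroup X] [Module R X] [Module.Finite R X]
    (f : T →ₗ[R] E) (g : E →ₗ[R] X) (hg : Function.Surjective g)
    (hfg : LinearMap.range f = LinearMap.ker g)
    (h : E →ₗ[R] (I → T) ⧸ eventuallyZero R I T) (hh : h ∘ₗ f = reducedDiagonal R I T) :
    ∃ s : X →ₗ[R] E, g ∘ₗ s = LinearMap.id := by
  obtain ⟨n, q, hq⟩ := Module.Finite.exists_fin' R X
  obtain ⟨p, hp⟩ := Module.projective_lifting_property g q hg
  obtain ⟨y, hy⟩ := Module.projective_lifting_property (eventuallyZero R I T).mkQ (h ∘ₗ p)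
    (Submodule.mkQ_surjective _)
  obtain ⟨s, hs⟩ := IsNoetherian.noetherian (LinearMap.ker q)
  have key : ∀ z ∈ s, ∀ᶠ i in Filter.atTop, f (y z i) = p z := by
    intro z hz
    have hzq : q z = 0 := by
      have : z ∈ LinearMap.ker q := hs ▸ Submodule.subset_span hz
      exact this
    have hzp : p z ∈ LinearMap.range f := by
      rw [hfg, LinearMap.mem_ker, ← hzq]
      exact LinearMap.congr_fun hp z
    obtain ⟨t, ht⟩ := hzp
    have h1 : (eventuallyZero R I T).mkQ (y z) = (eventuallyZero R I T).mkQ (fun _ => t) := by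
      have h2 := LinearMap.congr_fun hy z
      have h3 := LinearMap.congr_fun hh t
      simp only [LinearMap.comp_apply] at h2 h3
      rw [h2, ← ht, h3]
      rfl
    have h4 : y z - (fun _ => t) ∈ eventuallyZero R I T := (Submodule.Quotient.eq _).1 h1
    have h5 : ∀ᶠ i in Filter.atTop, (y z - (fun _ => t) : I → T) i = 0 := h4
    filter_upwards [h5] with i hi
    rw [← ht, sub_eq_zero.1 hi]
  obtain ⟨i, hi⟩ := ((Filter.eventually_all_finset s).2 key).exists
  refine exists_section_of_eqOn_ker q hq g p hp (f ∘ₗ LinearMap.proj i ∘ₗ y) ?_ ?_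
  · ext z
    have : f (y (Pi.single z 1) i) ∈ LinearMap.ker g := hfg ▸ LinearMap.mem_range_self f _
    simpa using this
  · intro z hz
    rw [← hs] at hz
    exact LinearMap.eqOn_span (f := f ∘ₗ LinearMap.proj i ∘ₗ y) (g := p) (fun z hz => hi z hz) hz

/-- A compatible extension problem that is solvable on all members of a directed family of
submodules covering `E` is solvable on `E` with values in the reduced power. -/
theorem exists_linearMap_reducedPower {I T E : Type*} [Preorder I] [Nonempty I]
    [IsDirectedOrder I] [AddCommGroup T] [Module R T] [AddCommGroup E] [Module R E]
    (F : I → Submodule R E) (hF : ∀ e, ∀ᶠ i in Filter.atTop, e ∈ F i)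
    (θ : ∀ i, F i →ₗ[R] T) :
    ∃ Θ : E →ₗ[R] (I → T) ⧸ eventuallyZero R I T,
      ∀ e t, (∀ i (h : e ∈ F i), θ i ⟨e, h⟩ = t) → Θ e = reducedDiagonal R I T t := by
  classical
  let c : E → I → T := fun e i => if h : e ∈ F i then θ i ⟨e, h⟩ else 0
  have hmk : ∀ a b : I → T, (∀ᶠ i in Filter.atTop, a i = b i) →
      (eventuallyZero R I T).mkQ a = (eventuallyZero R I T).mkQ b := by
    intro a b hab
    refine (Submodule.Quotient.eq _).2 ?_
    change ∀ᶠ i in Filter.atTop, (a - b) i = 0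
    filter_upwards [hab] with i hi
    simp [hi]
  refine ⟨⟨⟨fun e => (eventuallyZero R I T).mkQ (c e), ?_⟩, ?_⟩, ?_⟩
  · intro a b
    rw [← map_add]
    apply hmk
    filter_upwards [hF a, hF b] with i ha hb
    simp only [c, Pi.add_apply, dif_pos ha, dif_pos hb, dif_pos ((F i).add_mem ha hb)]
    rw [← map_add]
    rfl
  · intro r a
    change _ = r • (eventuallyZero R I T).mkQ (c a)
    rw [← map_smul]
    apply hmk
    filter_upwards [hF a] with i ha
    simp only [c, Pi.smul_apply, dif_pos ha, dif_pos ((F i).smul_mem r ha)]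
    rw [← map_smul]
    rfl
  · intro e t het
    refine hmk (c e) (fun _ => t) ?_
    filter_upwards [hF e] with i hi
    simp only [c, dif_pos hi, het i hi]

end Generic

namespace IsAlmostSplitSeq

variable {T E X : Modc A} {f : T →ₗ[Aᵐᵒᵖ] E} {g : E →ₗ[Aᵐᵒᵖ] X}

/-- No map `E → T` restricts to the identity on a nonzero submodule of `T`. -/
theorem eq_zero_of_comp_eq (h : IsAlmostSplitSeq T E X f g) {N : Modc A} (v : N →ₗ[Aᵐᵒᵖ] T)
    (θ : E →ₗ[Aᵐᵒᵖ] T) (hθ : θ ∘ₗ f ∘ₗ v = v) : v = 0 := by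
  by_contra hv
  have hns : ¬ IsSplitMono (LinearMap.id - θ ∘ₗ f) := by
    rintro ⟨r, hr⟩
    apply hv
    ext x
    have h1 : θ (f (v x)) = v x := LinearMap.congr_fun hθ x
    have h2 := LinearMap.congr_fun hr (v x)
    simpa [h1] using h2.symm
  obtain ⟨k, hk⟩ := h.2.2.2.2.2.2.2 T _ hns
  refine h.not_isSplitMono ⟨θ + k, ?_⟩
  rw [LinearMap.add_comp, hk]
  abel

/-- The kernel term of an almost split sequence ending in a finitely generated module is
algebraically compact: retractions onto the image of `v`, defined on the finitely generated
submodules of `E` containing it, can only exist if `v` vanishes. -/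
theorem eq_zero_of_forall_fg [IsNoetherianRing Aᵐᵒᵖ] (h : IsAlmostSplitSeq T E X f g)
    (hX : FinGen X) {N : Modc A} (hN : FinGen N) (v : N →ₗ[Aᵐᵒᵖ] T)
    (H : ∀ F : Submodule Aᵐᵒᵖ E, F.FG → LinearMap.range (f ∘ₗ v) ≤ F →
      ∃ θ : F →ₗ[Aᵐᵒᵖ] T, ∀ x (hx : f (v x) ∈ F), θ ⟨f (v x), hx⟩ = v x) : v = 0 := by
  have : Module.Finite Aᵐᵒᵖ X := hX
  have : Module.Finite Aᵐᵒᵖ N := hN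
  let I := {F : Submodule Aᵐᵒᵖ E // F.FG ∧ LinearMap.range (f ∘ₗ v) ≤ F}
  have hr : (LinearMap.range (f ∘ₗ v)).FG := by
    rw [LinearMap.range_eq_map]
    exact Module.Finite.fg_top.map _
  have : Nonempty I := ⟨⟨_, hr, le_rfl⟩⟩
  have : IsDirectedOrder I := ⟨fun a b =>
    ⟨⟨a.1 ⊔ b.1, a.2.1.sup b.2.1, a.2.2.trans le_sup_left⟩,
      show a.1 ≤ a.1 ⊔ b.1 from le_sup_left, show b.1 ≤ a.1 ⊔ b.1 from le_sup_right⟩⟩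
  choose θ hθ using fun i : I => H i.1 i.2.1 i.2.2
  have hF : ∀ e : E, ∀ᶠ i : I in Filter.atTop, e ∈ i.1 := by
    intro e
    refine Filter.eventually_atTop.2 ⟨⟨LinearMap.range (f ∘ₗ v) ⊔ Submodule.span Aᵐᵒᵖ {e},
      hr.sup (Submodule.fg_span_singleton e), le_sup_left⟩, fun i hi => ?_⟩
    have hi' : LinearMap.range (f ∘ₗ v) ⊔ Submodule.span Aᵐᵒᵖ {e} ≤ i.1 := hi
    exact hi' (Submodule.mem_sup_right (Submodule.mem_span_singleton_self e))
  obtain ⟨Θ, hΘ⟩ := exists_linearMap_reducedPower (fun i : I => i.1) hF θ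
  have hsplit : IsSplitMono (N := ModuleCat.of Aᵐᵒᵖ ((I → T) ⧸ eventuallyZero Aᵐᵒᵖ I T))
      (reducedDiagonal Aᵐᵒᵖ I T) := by
    by_contra hns
    obtain ⟨k, hk⟩ := h.2.2.2.2.2.2.2 _ _ hns
    exact h.2.2.2.2.2.1 (exists_section_of_reducedDiagonal_extends f g h.2.1 h.2.2.1 k hk)
  obtain ⟨π, hπ⟩ := hsplit
  refine h.eq_zero_of_comp_eq v (π ∘ₗ Θ) ?_
  ext x
  have h1 : Θ (f (v x)) = _ := hΘ (f (v x)) (v x) fun i hi => hθ i x hi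
  exact (congrArg π h1).trans (LinearMap.congr_fun hπ (v x))

end IsAlmostSplitSeq

theorem IsARComponent.mem_of_bijective {C : Set (Modc A)} (hC : IsARComponent C) {Y Z : Modc A}
    (hY : Y ∈ C) (hZ : FinGen Z) (hZi : Indec Z) (e : Y →ₗ[Aᵐᵒᵖ] Z)
    (he : Function.Bijective e) : Z ∈ C :=
  hC.2.2.1 Y hY Z ⟨(hC.2.1 Y hY).1, hZ, (hC.2.1 Y hY).2, hZi,
    Or.inl ⟨LinearEquiv.ofBijective e he⟩⟩

theorem IsARComponent.mem_of_bijective' {C : Set (Modc A)} (hC : IsARComponent C) {Y Z : Modc A}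
    (hY : Y ∈ C) (hZ : FinGen Z) (hZi : Indec Z) (e : Z →ₗ[Aᵐᵒᵖ] Y)
    (he : Function.Bijective e) : Z ∈ C :=
  hC.mem_of_bijective hY hZ hZi (LinearEquiv.ofBijective e he).symm.toLinearMap
    (LinearEquiv.bijective _)

/-- If `X ∉ C` has a nonzero map to `L ∈ C`, then for `N → Y → X` with `N ∈ C` some endomorphism
of `Y` is the identity on the image of `N` and is killed by `Y → X → L`. -/
theorem IsARComponent.exists_endomorphism [IsArtinianRing Aᵐᵒᵖ] {C : Set (Modc A)}
    (hC : IsARComponent C) (hne : ¬ HasExtShortPath C) {X N L : Modc A} (hX : FinGen X)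
    (hXi : Indec X) (hXC : X ∉ C) (hN : N ∈ C) (hL : L ∈ C) (u : X →ₗ[Aᵐᵒᵖ] L) (hu : u ≠ 0)
    (Y : Modc A) (hY : FinGen Y) (n : N →ₗ[Aᵐᵒᵖ] Y) (g : Y →ₗ[Aᵐᵒᵖ] X) :
    ∃ e : Y →ₗ[Aᵐᵒᵖ] Y, e ∘ₗ n = n ∧ u ∘ₗ g ∘ₗ e = 0 := by
  induction hl : Module.length Aᵐᵒᵖ Y using WellFoundedLT.induction generalizing Y with
  | ind l ih =>
  subst hl
  by_cases hYi : Indec Y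
  · by_cases hn : n = 0
    · exact ⟨0, by simp [hn], by simp⟩
    refine ⟨LinearMap.id, rfl, ?_⟩
    by_contra hug
    have hg : g ≠ 0 := by
      rintro rfl
      simp at hug
    by_cases hYC : Y ∈ C
    · exact hne ⟨Y, X, L, hYC, hL, hXC, hX, hXi,
        ⟨g, hg, fun hb => hXC (hC.mem_of_bijective hYC hX hXi g hb)⟩,
        ⟨u, hu, fun hb => hXC (hC.mem_of_bijective' hL hX hXi u hb)⟩⟩
    · exact hne ⟨N, Y, L, hN, hL, hYC, hY, hYi,
        ⟨n, hn, fun hb => hYC (hC.mem_of_bijective hN hY hYi n hb)⟩,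
        ⟨u ∘ₗ g, hug, fun hb => hYC (hC.mem_of_bijective' hL hY hYi (u ∘ₗ g) hb)⟩⟩
  · by_cases hnt : Nontrivial Y
    · have : ∃ p : Y →ₗ[Aᵐᵒᵖ] Y, p ∘ₗ p = p ∧ p ≠ 0 ∧ p ≠ LinearMap.id := by
        by_contra! hcon
        exact hYi ⟨hnt, fun e he => or_iff_not_imp_left.2 fun h0 => hcon e he h0⟩
      obtain ⟨p, hpp, hp0, hp1⟩ := this
      have : Module.Finite Aᵐᵒᵖ Y := hY
      have hpart : ∀ r : Y →ₗ[Aᵐᵒᵖ] Y, LinearMap.range r ≠ ⊤ →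
          ∃ e : Y →ₗ[Aᵐᵒᵖ] Y, e ∘ₗ n = r ∘ₗ n ∧ u ∘ₗ g ∘ₗ e = 0 := by
        intro r hr
        obtain ⟨e, he, he'⟩ := ih _ (Submodule.length_lt hr)
          (ModuleCat.of Aᵐᵒᵖ (LinearMap.range r))
          (show Module.Finite Aᵐᵒᵖ (LinearMap.range r) from inferInstance)
          (r.rangeRestrict ∘ₗ n) (g ∘ₗ (LinearMap.range r).subtype) rfl
        refine ⟨(LinearMap.range r).subtype ∘ₗ e ∘ₗ r.rangeRestrict, ?_, ?_⟩
        · rw [LinearMap.comp_assoc, LinearMap.comp_assoc, he]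
          rfl
        · ext y
          exact LinearMap.congr_fun he' (r.rangeRestrict y)
      have hpy : ∀ y, p (p y) = p y := fun y => LinearMap.congr_fun hpp y
      obtain ⟨e₁, h₁, h₁'⟩ := hpart p fun htop => hp1 <| by
        ext y
        obtain ⟨z, rfl⟩ := LinearMap.range_eq_top.1 htop y
        exact hpy z
      obtain ⟨e₂, h₂, h₂'⟩ := hpart (LinearMap.id - p) fun htop => hp0 <| by
        ext y
        obtain ⟨z, rfl⟩ := LinearMap.range_eq_top.1 htop y
        simp [hpy]
      refine ⟨e₁ + e₂, ?_, ?_⟩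
      · rw [LinearMap.add_comp, h₁, h₂, ← LinearMap.add_comp]
        simp
      · rw [LinearMap.comp_add, LinearMap.comp_add, h₁', h₂', add_zero]
    · rw [not_nontrivial_iff_subsingleton] at hnt
      exact ⟨LinearMap.id, rfl, by ext y; simp [Subsingleton.elim y 0]⟩

theorem InAdd.exists_from_ne_zero {C : Set (Modc A)} {M : Modc A} (hM : InAdd C M) {X : Modc A}
    {u : X →ₗ[Aᵐᵒᵖ] M} (hu : u ≠ 0) : ∃ L ∈ C, ∃ u' : X →ₗ[Aᵐᵒᵖ] L, u' ≠ 0 := by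
  obtain ⟨k, F, hF, ⟨e⟩⟩ := hM
  by_contra! hcon
  apply hu
  ext x
  apply e.injective
  funext i
  simpa using LinearMap.congr_fun
    (hcon (F i) (hF i) (LinearMap.proj i ∘ₗ e.toLinearMap ∘ₗ u)) x

theorem InAdd.exists_to_ne_zero {C : Set (Modc A)} {M : Modc A} (hM : InAdd C M) {T : Modc A}
    {v : M →ₗ[Aᵐᵒᵖ] T} (hv : v ≠ 0) : ∃ N ∈ C, ∃ v' : N →ₗ[Aᵐᵒᵖ] T, v' ≠ 0 := by
  obtain ⟨k, F, hF, ⟨e⟩⟩ := hM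
  by_contra! hcon
  apply hv
  have h0 : v ∘ₗ e.symm.toLinearMap = 0 := by
    refine LinearMap.pi_ext' fun i => ?_
    rw [LinearMap.zero_comp]
    exact hcon (F i) (hF i) _
  ext x
  simpa using LinearMap.congr_fun h0 (e x)

/-- If `M ∈ add C` for a component `C` without external short
paths and `M` is the middle of a short chain `X → M → τ_A X`, then `X ∈ C`. -/
theorem middle_of_short_chain_mem_component
    (K : Type u) [CommRing K] [IsArtinianRing K]
    (A : Type u) [Ring A] [Algebra K A] [Module.Finite K A]
    (C : Set (Modc A)) (hC : IsARComponent C) (hne : ¬ HasExtShortPath C)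
    (M : Modc A) (hM : InAdd C M)
    (X T E : Modc A) (hX : FinGen X) (hXi : Indec X)
    (f : T →ₗ[Aᵐᵒᵖ] E) (g : E →ₗ[Aᵐᵒᵖ] X)
    (hars : IsAlmostSplitSeq T E X f g)
    (hXtoM : ∃ u : X →ₗ[Aᵐᵒᵖ] M, u ≠ 0)
    (hMtoT : ∃ v : M →ₗ[Aᵐᵒᵖ] T, v ≠ 0) :
    X ∈ C := by
  have : IsArtinianRing Aᵐᵒᵖ := by
    have : Module.Finite K Aᵐᵒᵖ := Module.Finite.equiv (MulOpposite.opLinearEquiv K)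
    exact isArtinian_of_tower K inferInstance
  by_contra hXC
  obtain ⟨u₀, hu₀⟩ := hXtoM
  obtain ⟨v₀, hv₀⟩ := hMtoT
  obtain ⟨L, hL, u, hu⟩ := hM.exists_from_ne_zero hu₀
  obtain ⟨N, hN, v, hv⟩ := hM.exists_to_ne_zero hv₀
  obtain ⟨hf, -, hfg, -, -, -, hlift, -⟩ := id hars
  have hns : ¬ IsSplitEpi (M := ModuleCat.of Aᵐᵒᵖ (LinearMap.ker u)) (LinearMap.ker u).subtype := by
    rintro ⟨s, hs⟩
    apply hu
    ext x
    have h1 : ((s x : LinearMap.ker u) : X) = x := LinearMap.congr_fun hs x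
    have h2 : u (s x : LinearMap.ker u) = 0 := (s x).2
    rwa [h1] at h2
  obtain ⟨k, hk⟩ := hlift _ _ hns
  have hgf : ∀ t, g (f t) = 0 := fun t => by
    have : f t ∈ LinearMap.ker g := hfg ▸ LinearMap.mem_range_self f t
    exact this
  refine hv (hars.eq_zero_of_forall_fg hX (hC.2.1 N hN).1 v fun F hF hvF => ?_)
  have hmem : ∀ x, f (v x) ∈ F := fun x => hvF ⟨x, rfl⟩
  obtain ⟨e, he, he'⟩ := hC.exists_endomorphism hne hX hXi hXC hN hL u hu
    (ModuleCat.of Aᵐᵒᵖ F) (Module.Finite.iff_fg.2 hF) ((f ∘ₗ v).codRestrict F hmem)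
    (g ∘ₗ F.subtype)
  let w : F →ₗ[Aᵐᵒᵖ] LinearMap.ker u :=
    (g ∘ₗ F.subtype ∘ₗ e).codRestrict _ fun y => LinearMap.congr_fun he' y
  let d : F →ₗ[Aᵐᵒᵖ] E := F.subtype ∘ₗ e - k ∘ₗ w
  have hd : ∀ y, d y ∈ LinearMap.range f := by
    intro y
    have h1 : g (k (w y)) = g (e y : F) := LinearMap.congr_fun hk (w y)
    rw [hfg, LinearMap.mem_ker]
    simp [d, h1]
  refine ⟨(LinearEquiv.ofInjective f hf).symm.toLinearMap ∘ₗ d.codRestrict _ hd, fun x hx => ?_⟩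
  have h1 : e ⟨f (v x), hx⟩ = ⟨f (v x), hx⟩ := LinearMap.congr_fun he x
  have h2 : w ⟨f (v x), hx⟩ = 0 := Subtype.ext <| by
    change g ((e ⟨f (v x), hx⟩ : F) : E) = 0
    rw [h1]
    exact hgf _
  change (LinearEquiv.ofInjective f hf).symm _ = _
  rw [LinearEquiv.symm_apply_eq]
  apply Subtype.ext
  change ((e ⟨f (v x), hx⟩ : F) : E) - k (w ⟨f (v x), hx⟩) = f (v x)
  rw [h1, h2, map_zero, sub_zero]
end
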